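/- arXiv:0901.1485 — 14 statements merged into one kernel-verified Lean document; each statement's English description precedes it below -/
import Mathlib

section
/- Let R be a commutative ring, q ∈ R a unit, and A an associative unital R-algebra. If α, β, γ, δ ∈ A satisfy the Reflection Equation (RE) relations, then the elements c1 = β − qγ and c2 = αδ − q²βγ commute with each of α, β, γ, δ (hence c1 and c2 are central in the subalgebra generated by α, β, γ, δ). -/
/-- Elements `α β γ δ` of an associative unital `R`-algebra satisfy the
Reflection Equation (RE) relations (with parameter the unit `q`). -/
def REREl {R A : Type} [CommRing R] [Ring A] [Algebra R A] (q : Rˣ)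
    (α β γ δ : A) : Prop :=
  α * β - β * α = ((q : R) - ((q⁻¹ : Rˣ) : R)) • (α * γ) ∧
  α * γ = ((q : R) ^ 2) • (γ * α) ∧
  α * δ - δ * α = ((q : R) - ((q⁻¹ : Rˣ) : R)) • (((q : R) • β + γ) * γ) ∧
  β * γ = γ * β ∧
  β * δ - δ * β = ((q : R) - ((q⁻¹ : Rˣ) : R)) • (γ * δ) ∧
  γ * δ = ((q : R) ^ 2) • (δ * γ)

/-- If `α β γ δ` satisfy the RE relations, then the elements
`c₁ = β - qγ` and `c₂ = αδ - q²βγ` commute with each of `α, β, γ, δ`. -/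
theorem RE_casimirs_central {R A : Type} [CommRing R] [Ring A] [Algebra R A]
    (q : Rˣ) (α β γ δ : A) (h : REREl q α β γ δ) :
    (∀ x ∈ ({α, β, γ, δ} : Set A), Commute (β - (q : R) • γ) x) ∧
      (∀ x ∈ ({α, β, γ, δ} : Set A),
        Commute (α * δ - ((q : R) ^ 2) • (β * γ)) x) := by
  obtain ⟨hαβ, hαγ, hαδ, hβγ, hβδ, hγδ⟩ := h
  generalize hv : ((q⁻¹ : Rˣ) : R) = v at *
  have hqv : (q : R) * v = 1 := by rw [← hv, Units.mul_inv]
  generalize (q : R) = u at *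
  have hsmul : ∀ x : A, v ^ 2 • u ^ 2 • x = x := fun x => by
    rw [smul_smul, ← mul_pow, mul_comm v u, hqv, one_pow, one_smul]
  have hβα : β * α = α * β - (u - v) • (α * γ) := by rw [← hαβ, sub_sub_cancel]
  have hγα : γ * α = v ^ 2 • (α * γ) := by rw [hαγ, hsmul]
  have hδα : δ * α = α * δ - (u - v) • ((u • β + γ) * γ) := by rw [← hαδ, sub_sub_cancel]
  have hδβ : δ * β = β * δ - (u - v) • (γ * δ) := by rw [← hβδ, sub_sub_cancel]
  have hδγ : δ * γ = v ^ 2 • (γ * δ) := by rw [hγδ, hsmul]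
  have assoc {a b c : A} (hab : a * b = c) (x : A) : a * (b * x) = c * x := by
    rw [← mul_assoc, hab]
  constructor <;> rintro x (rfl | rfl | rfl | rfl) <;>
    simp only [commute_iff_eq, sub_mul, mul_sub, add_mul, mul_add, smul_mul_assoc, mul_smul_comm,
      mul_assoc, smul_sub, smul_add, hβα, hγα, hδα, ← hβγ, hδβ, hδγ, assoc hβα, assoc hγα,
      assoc hδα, assoc hβγ.symm, assoc hδβ] <;>
    match_scalars <;> grind
end

section
/- Let R be a commutative ring, q ∈ R a unit, and A an associative unital R-algebra. Suppose a, b, c, d ∈ A satisfy the GL_q(2) relations, α, β, γ, δ ∈ A satisfy the RE relations, and each of a, b, c, d commutes with each of α, β, γ, δ. Define (as the entries of the 2×2 matrix product T K Tᵗ with T = [[a,b],[c,d]], K = [[α,β],[γ,δ]], Tᵗ = [[a,c],[b,d]]): α' = (aα + bγ)a + (aβ + bδ)b, β' = (aα + bγ)c + (aβ + bδ)d, γ' = (cα + dγ)a + (cβ + dδ)b, δ' = (cα + dγ)c + (cβ + dδ)d. Then α', β', γ', δ' again satisfy the RE relations (i.e. the RE algebra is a GL_q(2)-comodule algebra). 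-/
/-- Elements `a b c d` satisfy the `GL_q(2)` relations. -/
def GLq2Rel {R A : Type} [CommRing R] [Ring A] [Algebra R A] (q : Rˣ)
    (a b c d : A) : Prop :=
  a * b = (q : R) • (b * a) ∧
  a * c = (q : R) • (c * a) ∧
  b * d = (q : R) • (d * b) ∧
  c * d = (q : R) • (d * c) ∧
  b * c = c * b ∧
  a * d - d * a = ((q : R) - ((q⁻¹ : Rˣ) : R)) • (b * c)

/-- A rewriting rule for `x * y`, applied at the head of a right-associated product. -/
theorem mul_mul_of_mul_eq {M : Type*} [Semigroup M] {x y r : M} (h : x * y = r) (t : M) :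
    x * (y * t) = r * t := by
  rw [← mul_assoc, h]

theorem eq_smul_of_eq_smul {R M : Type*} [CommRing R] [AddCommGroup M] [Module R M]
    {k l : R} (h : k * l = 1) {x y : M} (hxy : x = k • y) : y = l • x := by
  rw [hxy, smul_smul, mul_comm l k, h, one_smul]

set_option maxHeartbeats 1000000 in
/-- If `a b c d` satisfy the `GL_q(2)` relations, `α β γ δ` satisfy
the RE relations, and the two quadruples mutually commute, then the entries of
`T K Tᵗ` again satisfy the RE relations (the RE algebra is a `GL_q(2)`-comodule
algebra). -/
theorem RE_comodule_GLq2 {R A : Type} [CommRing R] [Ring A] [Algebra R A]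
    (q : Rˣ) (a b c d α β γ δ : A)
    (hT : GLq2Rel q a b c d) (hK : REREl q α β γ δ)
    (hcomm : ∀ x ∈ ({a, b, c, d} : Set A), ∀ y ∈ ({α, β, γ, δ} : Set A),
      Commute x y) :
    REREl q
      ((a * α + b * γ) * a + (a * β + b * δ) * b)
      ((a * α + b * γ) * c + (a * β + b * δ) * d)
      ((c * α + d * γ) * a + (c * β + d * δ) * b)
      ((c * α + d * γ) * c + (c * β + d * δ) * d) := by
  obtain ⟨hab, hac, hbd, hcd, hbc, had⟩ := hT
  obtain ⟨hXY, hXZ, hXW, hYZ, hYW, hZW⟩ := hK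
  have hqp : (q : R) * ((q⁻¹ : Rˣ) : R) = 1 := q.mul_inv
  unfold REREl
  generalize ((q⁻¹ : Rˣ) : R) = p at *
  generalize (q : R) = q at *
  have hqp2 : q ^ 2 * p ^ 2 = 1 := by rw [← mul_pow, hqp, one_pow]
  have hba : b * a = p • (a * b) := eq_smul_of_eq_smul hqp hab
  have hca : c * a = p • (a * c) := eq_smul_of_eq_smul hqp hac
  have hdb : d * b = p • (b * d) := eq_smul_of_eq_smul hqp hbd
  have hdc : d * c = p • (c * d) := eq_smul_of_eq_smul hqp hcd
  have hcb : c * b = b * c := hbc.symm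
  have hda : d * a = a * d - (q - p) • (b * c) := by rw [← had, sub_sub_cancel]
  have hYX : β * α = α * β - (q - p) • (α * γ) := by rw [← hXY, sub_sub_cancel]
  have hZX : γ * α = p ^ 2 • (α * γ) := eq_smul_of_eq_smul hqp2 hXZ
  have hWX : δ * α = α * δ - (q - p) • (q • (β * γ) + γ * γ) := by
    rw [← smul_mul_assoc, ← add_mul, ← hXW, sub_sub_cancel]
  have hZY : γ * β = β * γ := hYZ.symm
  have hWY : δ * β = β * δ - (q - p) • (γ * δ) := by rw [← hYW, sub_sub_cancel]
  have hWZ : δ * γ = p ^ 2 • (γ * δ) := eq_smul_of_eq_smul hqp2 hZW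
  have hXa : α * a = a * α := (hcomm a (by simp) α (by simp)).symm
  have hYa : β * a = a * β := (hcomm a (by simp) β (by simp)).symm
  have hZa : γ * a = a * γ := (hcomm a (by simp) γ (by simp)).symm
  have hWa : δ * a = a * δ := (hcomm a (by simp) δ (by simp)).symm
  have hXb : α * b = b * α := (hcomm b (by simp) α (by simp)).symm
  have hYb : β * b = b * β := (hcomm b (by simp) β (by simp)).symm
  have hZb : γ * b = b * γ := (hcomm b (by simp) γ (by simp)).symm
  have hWb : δ * b = b * δ := (hcomm b (by simp) δ (by simp)).symm
  have hXc : α * c = c * α := (hcomm c (by simp) α (by simp)).symm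
  have hYc : β * c = c * β := (hcomm c (by simp) β (by simp)).symm
  have hZc : γ * c = c * γ := (hcomm c (by simp) γ (by simp)).symm
  have hWc : δ * c = c * δ := (hcomm c (by simp) δ (by simp)).symm
  have hXd : α * d = d * α := (hcomm d (by simp) α (by simp)).symm
  have hYd : β * d = d * β := (hcomm d (by simp) β (by simp)).symm
  have hZd : γ * d = d * γ := (hcomm d (by simp) γ (by simp)).symm
  have hWd : δ * d = d * δ := (hcomm d (by simp) δ (by simp)).symm
  refine ⟨?_, ?_, ?_, ?_, ?_, ?_⟩
  all_goals
    simp only [mul_add, add_mul, mul_sub, sub_mul, mul_assoc, smul_mul_assoc, mul_smul_comm,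
      mul_mul_of_mul_eq hba, mul_mul_of_mul_eq hca, mul_mul_of_mul_eq hdb,
      mul_mul_of_mul_eq hdc, mul_mul_of_mul_eq hcb, mul_mul_of_mul_eq hda, hYX, hZX, hWX, hZY,
      hWY, hWZ, hXa, mul_mul_of_mul_eq hXa, mul_mul_of_mul_eq hYa, hZa, mul_mul_of_mul_eq hZa,
      mul_mul_of_mul_eq hWa, mul_mul_of_mul_eq hXb, hYb, mul_mul_of_mul_eq hYb,
      mul_mul_of_mul_eq hZb, hWb, mul_mul_of_mul_eq hWb, hXc, mul_mul_of_mul_eq hXc,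
      mul_mul_of_mul_eq hYc, hZc, mul_mul_of_mul_eq hZc, mul_mul_of_mul_eq hWc,
      mul_mul_of_mul_eq hXd, hYd, mul_mul_of_mul_eq hYd, mul_mul_of_mul_eq hZd, hWd,
      mul_mul_of_mul_eq hWd]
    match_scalars <;> grind
end

section
/- Let R be a commutative ring, q ∈ R a unit, A an associative unital R-algebra, and k ≥ 2. Suppose α, β, γ, δ ∈ A satisfy the RE relations, and for l = 1, ..., k−1 the quadruples (a_l, b_l, c_l, d_l) each satisfy the GL_q(2) relations; suppose moreover that elements of quadruples with different indices l commute with each other, and every a_l, b_l, c_l, d_l commutes with each of α, β, γ, δ. Let K^(k) = [[α^(k), β^(k)],[γ^(k), δ^(k)]] be the 2×2 matrix over A defined by K^(k) = T_{k−1} ⋯ T_2 T_1 · K · T_1ᵗ T_2ᵗ ⋯ T_{k−1}ᵗ, where T_l = [[a_l, b_l],[c_l, d_l]], T_lᵗ = [[a_l, c_l],[b_l, d_l]], K = [[α, β],[γ, δ]], and products are matrix products over the (noncommutative) algebra A. Then β^(k) − q γ^(k) = (∏_{l=1}^{k−1} (a_l d_l − q b_l c_l)) · (β − qγ). -/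
/-- The matrix `T_l = [[a_l, b_l],[c_l, d_l]]`. -/
def Tmat {A : Type} [Ring A] (a b c d : ℕ → A) (l : ℕ) : Matrix (Fin 2) (Fin 2) A :=
  !![a l, b l; c l, d l]

/-- The iterated coaction image: `KIter K a b c d j = T_j ⋯ T_1 ⬝ K ⬝ T_1ᵗ ⋯ T_jᵗ`,
so that `K^(k) = KIter K a b c d (k-1)`. -/
def KIter {A : Type} [Ring A] (K : Matrix (Fin 2) (Fin 2) A) (a b c d : ℕ → A) :
    ℕ → Matrix (Fin 2) (Fin 2) A
  | 0 => K
  | j + 1 => Tmat a b c d (j + 1) * KIter K a b c d j * (Tmat a b c d (j + 1)).transpose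

theorem KIter_apply_mem {A : Type} [Ring A] (S : Subring A) {K : Matrix (Fin 2) (Fin 2) A}
    {a b c d : ℕ → A} (n : ℕ) (hK : ∀ i j, K i j ∈ S)
    (hT : ∀ l, 1 ≤ l → l ≤ n → ∀ i j, Tmat a b c d l i j ∈ S) (i j : Fin 2) :
    KIter K a b c d n i j ∈ S := by
  induction n generalizing i j with
  | zero => exact hK i j
  | succ n ih =>
    have ih' := ih fun l h₁ h₂ => hT l h₁ (h₂.trans n.le_succ)
    have hT' := hT (n + 1) n.succ_pos le_rfl
    simp only [KIter, Matrix.mul_apply, Matrix.transpose_apply]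
    exact sum_mem fun m _ => mul_mem (sum_mem fun p _ => mul_mem (hT' i p) (ih' p m)) (hT' j m)

theorem GLq2Rel.qAntisymm_conj {R A : Type} [CommRing R] [Ring A] [Algebra R A] {q : Rˣ}
    {a b c d : A} (h : GLq2Rel q a b c d) (M : Matrix (Fin 2) (Fin 2) A)
    (hM : ∀ x ∈ ({a, b, c, d} : Set A), ∀ i j, Commute x (M i j)) :
    (!![a, b; c, d] * M * !![a, b; c, d].transpose) 0 1
        - (q : R) • (!![a, b; c, d] * M * !![a, b; c, d].transpose) 1 0 =
      (M 0 1 - (q : R) • M 1 0) * (a * d - (q : R) • (b * c)) := by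
  obtain ⟨-, hac, hbd, -, hbc, had⟩ := h
  have hda : (q : R) • (d * a) = (q : R) • (a * d) - ((q : R) ^ 2 - 1) • (b * c) := by
    have hq : (q : R) * ((q : R) - ((q⁻¹ : Rˣ) : R)) = (q : R) ^ 2 - 1 := by
      rw [mul_sub, Units.mul_inv, sq]
    rw [← hq, mul_smul, ← had, smul_sub, sub_sub_cancel]
  have ha := hM a (by simp)
  have hb := hM b (by simp)
  have hc := hM c (by simp)
  have hd := hM d (by simp)
  simp only [Matrix.mul_apply, Fin.sum_univ_two, Matrix.transpose_apply, Matrix.of_apply,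
    Matrix.cons_val', Matrix.cons_val_zero, Matrix.cons_val_one, Matrix.cons_val_fin_one,
    (ha _ _).eq, (hb _ _).eq, (hc _ _).eq, (hd _ _).eq, add_mul, mul_assoc, smul_add]
  simp only [← mul_smul_comm, hda, hac, hbd, ← hbc]
  simp only [mul_sub, sub_mul, mul_smul_comm, smul_mul_assoc, smul_sub, sub_smul, one_smul,
    smul_smul, sq]
  abel

/-- Under the RE relations for `K = [[α,β],[γ,δ]]` and the
`GL_q(2)` relations for each `T_l` (`1 ≤ l ≤ k-1`), with the appropriate mutual
commutativity, the entries of `K^(k) = T_{k-1}⋯T_1 K T_1ᵗ⋯T_{k-1}ᵗ` satisfy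
`β^(k) - q γ^(k) = (∏_{l=1}^{k-1} det_q T_l) (β - qγ)`. -/
theorem RE_c1_factorizes {R A : Type} [CommRing R] [Ring A] [Algebra R A]
    (q : Rˣ) (k : ℕ) (hk : 2 ≤ k) (α β γ δ : A) (a b c d : ℕ → A)
    (hK : REREl q α β γ δ)
    (hT : ∀ l, 1 ≤ l → l ≤ k - 1 → GLq2Rel q (a l) (b l) (c l) (d l))
    (hTT : ∀ l l', 1 ≤ l → l ≤ k - 1 → 1 ≤ l' → l' ≤ k - 1 → l ≠ l' →
      ∀ x ∈ ({a l, b l, c l, d l} : Set A), ∀ y ∈ ({a l', b l', c l', d l'} : Set A),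
        Commute x y)
    (hTK : ∀ l, 1 ≤ l → l ≤ k - 1 →
      ∀ x ∈ ({a l, b l, c l, d l} : Set A), ∀ y ∈ ({α, β, γ, δ} : Set A),
        Commute x y) :
    KIter !![α, β; γ, δ] a b c d (k - 1) 0 1
        - (q : R) • KIter !![α, β; γ, δ] a b c d (k - 1) 1 0 =
      ((List.range (k - 1)).map
          (fun j => a (j + 1) * d (j + 1) - (q : R) • (b (j + 1) * c (j + 1)))).prod
        * (β - (q : R) • γ) := by
  clear hK
  obtain ⟨n, rfl⟩ : ∃ n, k = n + 1 := ⟨k - 1, by omega⟩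
  simp only [Nat.add_sub_cancel] at *
  clear hk
  induction n with
  | zero => simp [KIter]
  | succ n ih =>
    have hx : ∀ x ∈ ({a (n + 1), b (n + 1), c (n + 1), d (n + 1)} : Set A), ∀ i j,
        Commute x (KIter !![α, β; γ, δ] a b c d n i j) := by
      intro x hx i j
      refine (Subring.mem_centralizer_iff.1 (KIter_apply_mem (Subring.centralizer {x}) n ?_ ?_ i j)
        x rfl)
      · intro i j
        refine Subring.mem_centralizer_iff.2 ?_
        rintro _ rfl
        exact hTK (n + 1) n.succ_pos le_rfl _ hx _ (by fin_cases i <;> fin_cases j <;> simp)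
      · intro l h₁ h₂ i j
        refine Subring.mem_centralizer_iff.2 ?_
        rintro _ rfl
        exact hTT (n + 1) l n.succ_pos le_rfl h₁ (by omega) (by omega) _ hx _
          (by fin_cases i <;> fin_cases j <;> simp [Tmat])
    have step := (hT (n + 1) n.succ_pos le_rfl).qAntisymm_conj _ hx
    have hcomm : Commute (β - (q : R) • γ)
        (a (n + 1) * d (n + 1) - (q : R) • (b (n + 1) * c (n + 1))) := by
      have hTK' := hTK (n + 1) n.succ_pos le_rfl
      have key : ∀ y ∈ ({α, β, γ, δ} : Set A),
          Commute y (a (n + 1) * d (n + 1) - (q : R) • (b (n + 1) * c (n + 1))) := fun y hy =>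
        ((hTK' _ (by simp) y hy).symm.mul_right (hTK' _ (by simp) y hy).symm).sub_right
          (((hTK' _ (by simp) y hy).symm.mul_right (hTK' _ (by simp) y hy).symm).smul_right _)
      exact (key β (by simp)).sub_left ((key γ (by simp)).smul_left _)
    have ih' := ih (fun l h₁ h₂ => hT l h₁ (by omega))
      (fun l l' h₁ h₂ h₃ h₄ => hTT l l' h₁ (by omega) h₃ (by omega))
      (fun l h₁ h₂ => hTK l h₁ (by omega))
    rw [List.range_succ, List.map_append, List.prod_append, List.map_singleton,
      List.prod_singleton, mul_assoc, ← hcomm.eq, ← mul_assoc, ← ih']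
    exact step
end

section
/- Let R be a commutative ring, q ∈ R a unit, A an associative unital R-algebra, and k ≥ 2. Suppose α, β, γ, δ ∈ A satisfy the RE relations, and for l = 1, ..., k−1 the quadruples (a_l, b_l, c_l, d_l) each satisfy the GL_q(2) relations; suppose moreover that elements of quadruples with different indices l commute with each other, and every a_l, b_l, c_l, d_l commutes with each of α, β, γ, δ. Let K^(k) = [[α^(k), β^(k)],[γ^(k), δ^(k)]] = T_{k−1} ⋯ T_1 · K · T_1ᵗ ⋯ T_{k−1}ᵗ, where T_l = [[a_l, b_l],[c_l, d_l]], T_lᵗ = [[a_l, c_l],[b_l, d_l]], K = [[α, β],[γ, δ]], and products are matrix products over A. Then α^(k) δ^(k) − q² β^(k) γ^(k) = (∏_{l=1}^{k−1} (a_l d_l − q b_l c_l)²) · (αδ − q²βγ). -/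
theorem mul_left_of_mul_eq {A : Type} [Ring A] {x y e : A} (h : x * y = e) (z : A) :
    x * (y * z) = e * z := by
  rw [← mul_assoc, h]

theorem GLq2Rel.reorder {R A : Type} [CommRing R] [Ring A] [Algebra R A] {q : Rˣ} {a b c d : A}
    (h : GLq2Rel q a b c d) :
    b * a = ((q⁻¹ : Rˣ) : R) • (a * b) ∧ c * a = ((q⁻¹ : Rˣ) : R) • (a * c) ∧
      d * b = ((q⁻¹ : Rˣ) : R) • (b * d) ∧ d * c = ((q⁻¹ : Rˣ) : R) • (c * d) ∧
      c * b = b * c ∧ d * a = a * d - ((q : R) - ((q⁻¹ : Rˣ) : R)) • (b * c) := by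
  obtain ⟨hab, hac, hbd, hcd, hbc, had⟩ := h
  refine ⟨?_, ?_, ?_, ?_, hbc.symm, ?_⟩
  · simp [hab, smul_smul]
  · simp [hac, smul_smul]
  · simp [hbd, smul_smul]
  · simp [hcd, smul_smul]
  · rw [← had]; abel

theorem REREl.reorder {R A : Type} [CommRing R] [Ring A] [Algebra R A] {q : Rˣ} {α β γ δ : A}
    (h : REREl q α β γ δ) :
    α * γ = (q : R) ^ 2 • (γ * α) ∧ γ * δ = (q : R) ^ 2 • (δ * γ) ∧ γ * β = β * γ ∧
      α * β = β * α + (((q : R) - ((q⁻¹ : Rˣ) : R)) * (q : R) ^ 2) • (γ * α) ∧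
      β * δ = δ * β + (((q : R) - ((q⁻¹ : Rˣ) : R)) * (q : R) ^ 2) • (δ * γ) ∧
      α * δ = δ * α + (((q : R) - ((q⁻¹ : Rˣ) : R)) * (q : R)) • (β * γ) +
        ((q : R) - ((q⁻¹ : Rˣ) : R)) • (γ * γ) := by
  obtain ⟨hαβ, hαγ, hαδ, hβγ, hβδ, hγδ⟩ := h
  refine ⟨hαγ, hγδ, hβγ.symm, ?_, ?_, ?_⟩
  · rw [mul_smul, ← hαγ, ← hαβ]; abel
  · rw [mul_smul, ← hγδ, ← hβδ]; abel
  · rw [sub_eq_iff_eq_add] at hαδ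
    rw [hαδ, add_mul, smul_mul_assoc]
    module

set_option linter.unusedSimpArgs false in
set_option maxHeartbeats 4000000 in
/-- The coaction preserves the RE relations, and multiplies `αδ - q²βγ` by the squared
quantum determinant. -/
theorem REREl.coaction {R A : Type} [CommRing R] [Ring A] [Algebra R A] {q : Rˣ}
    {α β γ δ a b c d : A} (hK : REREl q α β γ δ) (hT : GLq2Rel q a b c d)
    (hTK : ∀ x ∈ ({a, b, c, d} : Set A), ∀ y ∈ ({α, β, γ, δ} : Set A), Commute x y) :
    let α' := (a * α + b * γ) * a + (a * β + b * δ) * b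
    let β' := (a * α + b * γ) * c + (a * β + b * δ) * d
    let γ' := (c * α + d * γ) * a + (c * β + d * δ) * b
    let δ' := (c * α + d * γ) * c + (c * β + d * δ) * d
    REREl q α' β' γ' δ' ∧
      α' * δ' - (q : R) ^ 2 • (β' * γ') =
        (a * d - (q : R) • (b * c)) ^ 2 * (α * δ - (q : R) ^ 2 • (β * γ)) := by
  simp only [Set.mem_insert_iff, Set.mem_singleton_iff, forall_eq_or_imp, forall_eq,
    commute_iff_eq] at hTK
  obtain ⟨⟨aα, aβ, aγ, aδ⟩, ⟨bα, bβ, bγ, bδ⟩, ⟨cα, cβ, cγ, cδ⟩, dα, dβ, dγ, dδ⟩ := hTK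
  obtain ⟨ba, ca, db, dc, cb, da⟩ := hT.reorder
  obtain ⟨αγ, γδ, γβ, αβ, βδ, αδ⟩ := hK.reorder
  unfold REREl
  clear hK hT
  have hq : (q : R) * ((q⁻¹ : Rˣ) : R) = 1 := q.mul_inv
  generalize (q : R) = s at *
  generalize ((q⁻¹ : Rˣ) : R) = t at *
  intro α' β' γ' δ'
  refine ⟨⟨?_, ?_, ?_, ?_, ?_, ?_⟩, ?_⟩
  all_goals
    simp only [α', β', γ', δ', pow_two (a * d - _), mul_add, add_mul, mul_sub, sub_mul, mul_assoc,
      ← aα, ← aβ, ← aγ, ← aδ, ← bα, ← bβ, ← bγ, ← bδ, ← cα, ← cβ, ← cγ, ← cδ, ← dα, ← dβ, ← dγ,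
      ← dδ, mul_left_of_mul_eq aα.symm, mul_left_of_mul_eq aβ.symm, mul_left_of_mul_eq aγ.symm,
      mul_left_of_mul_eq aδ.symm, mul_left_of_mul_eq bα.symm, mul_left_of_mul_eq bβ.symm,
      mul_left_of_mul_eq bγ.symm, mul_left_of_mul_eq bδ.symm, mul_left_of_mul_eq cα.symm,
      mul_left_of_mul_eq cβ.symm, mul_left_of_mul_eq cγ.symm, mul_left_of_mul_eq cδ.symm,
      mul_left_of_mul_eq dα.symm, mul_left_of_mul_eq dβ.symm, mul_left_of_mul_eq dγ.symm,
      mul_left_of_mul_eq dδ.symm, ba, ca, db, dc, cb, da, αγ, γδ, γβ, αβ, βδ, αδ,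
      mul_left_of_mul_eq ba, mul_left_of_mul_eq ca, mul_left_of_mul_eq db, mul_left_of_mul_eq dc,
      mul_left_of_mul_eq cb, mul_left_of_mul_eq da, mul_left_of_mul_eq αγ, mul_left_of_mul_eq γδ,
      mul_left_of_mul_eq γβ, mul_left_of_mul_eq αβ, mul_left_of_mul_eq βδ, mul_left_of_mul_eq αδ,
      smul_mul_assoc, mul_smul_comm, smul_add, smul_sub, smul_smul]
    match_scalars <;> grind

theorem KIter_succ_apply {A : Type} [Ring A] (K : Matrix (Fin 2) (Fin 2) A) (a b c d : ℕ → A)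
    (n : ℕ) :
    let M := KIter K a b c d n
    let x : Fin 2 → A := ![a (n + 1), c (n + 1)]
    let y : Fin 2 → A := ![b (n + 1), d (n + 1)]
    ∀ i j, KIter K a b c d (n + 1) i j =
      (x i * M 0 0 + y i * M 1 0) * x j + (x i * M 0 1 + y i * M 1 1) * y j := by
  intro M x y i j
  fin_cases i <;> fin_cases j <;>
    simp [KIter, Tmat, M, x, y, Matrix.mul_apply, Matrix.vecMul, dotProduct, Fin.sum_univ_two]

theorem commute_KIter {A : Type} [Ring A] {K : Matrix (Fin 2) (Fin 2) A} {a b c d : ℕ → A}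
    {x : A} {n : ℕ} (hK : ∀ i j, Commute x (K i j))
    (hx : ∀ l, 1 ≤ l → l ≤ n → ∀ y ∈ ({a l, b l, c l, d l} : Set A), Commute x y) (i j : Fin 2) :
    Commute x (KIter K a b c d n i j) := by
  induction n generalizing i j with
  | zero => exact hK i j
  | succ n ih =>
    have ih := ih fun l h1 h2 => hx l h1 (by lia)
    have hy := hx (n + 1) (by lia) le_rfl
    simp only [Set.mem_insert_iff, Set.mem_singleton_iff, forall_eq_or_imp, forall_eq] at hy
    obtain ⟨ha, hb, hc, hd⟩ := hy
    have hac : ∀ i : Fin 2, Commute x ((![a (n + 1), c (n + 1)] : Fin 2 → A) i) := by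
      simp [Fin.forall_fin_two, ha, hc]
    have hbd : ∀ i : Fin 2, Commute x ((![b (n + 1), d (n + 1)] : Fin 2 → A) i) := by
      simp [Fin.forall_fin_two, hb, hd]
    rw [KIter_succ_apply]
    exact ((((hac i).mul_right (ih 0 0)).add_right ((hbd i).mul_right (ih 1 0))).mul_right
      (hac j)).add_right ((((hac i).mul_right (ih 0 1)).add_right
        ((hbd i).mul_right (ih 1 1))).mul_right (hbd j))

theorem Commute.det_sq {R A : Type} [CommRing R] [Ring A] [Algebra R A] {q : R} {x a b c d : A}
    (h : ∀ y ∈ ({a, b, c, d} : Set A), Commute x y) :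
    Commute x ((a * d - q • (b * c)) ^ 2) := by
  simp only [Set.mem_insert_iff, Set.mem_singleton_iff, forall_eq_or_imp, forall_eq] at h
  obtain ⟨ha, hb, hc, hd⟩ := h
  exact ((ha.mul_right hd).sub_right ((hb.mul_right hc).smul_right q)).pow_right 2

theorem REREl.KIter {R A : Type} [CommRing R] [Ring A] [Algebra R A] {q : Rˣ}
    {K : Matrix (Fin 2) (Fin 2) A} {a b c d : ℕ → A} {n : ℕ}
    (hK : REREl q (K 0 0) (K 0 1) (K 1 0) (K 1 1))
    (hT : ∀ l, 1 ≤ l → l ≤ n → GLq2Rel q (a l) (b l) (c l) (d l))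
    (hTT : ∀ l l', 1 ≤ l → l ≤ n → 1 ≤ l' → l' ≤ n → l ≠ l' →
      ∀ x ∈ ({a l, b l, c l, d l} : Set A), ∀ y ∈ ({a l', b l', c l', d l'} : Set A),
        Commute x y)
    (hTK : ∀ l, 1 ≤ l → l ≤ n → ∀ x ∈ ({a l, b l, c l, d l} : Set A), ∀ i j, Commute x (K i j)) :
    let M := _root_.KIter K a b c d n
    REREl q (M 0 0) (M 0 1) (M 1 0) (M 1 1) ∧
      M 0 0 * M 1 1 - (q : R) ^ 2 • (M 0 1 * M 1 0) =
        ((List.range n).map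
          (fun j => (a (j + 1) * d (j + 1) - (q : R) • (b (j + 1) * c (j + 1))) ^ 2)).prod
        * (K 0 0 * K 1 1 - (q : R) ^ 2 • (K 0 1 * K 1 0)) := by
  induction n with
  | zero => simpa [_root_.KIter] using hK
  | succ n ih =>
    obtain ⟨hM, hdet⟩ := ih (fun l h1 h2 => hT l h1 (by lia))
      (fun l l' h1 h2 h3 h4 => hTT l l' h1 (by lia) h3 (by lia))
      (fun l h1 h2 => hTK l h1 (by lia))
    have hcomm : ∀ x ∈ ({a (n + 1), b (n + 1), c (n + 1), d (n + 1)} : Set A),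
        ∀ l, 1 ≤ l → l ≤ n → ∀ y ∈ ({a l, b l, c l, d l} : Set A), Commute x y :=
      fun x hx l h1 h2 => hTT (n + 1) l (by lia) le_rfl h1 (by lia) (by lia) x hx
    have hstep := hM.coaction (hT (n + 1) (by lia) le_rfl) (fun x hx y hy => by
      have h := commute_KIter (hTK (n + 1) (by lia) le_rfl x hx) (hcomm x hx)
      simp only [Set.mem_insert_iff, Set.mem_singleton_iff] at hy
      rcases hy with rfl | rfl | rfl | rfl <;> exact h _ _)
    intro M
    simp only [M, KIter_succ_apply, Matrix.cons_val_zero, Matrix.cons_val_one]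
    refine ⟨hstep.1, hstep.2.trans ?_⟩
    rw [hdet, List.range_succ, List.map_append, List.prod_append, List.map_singleton,
      List.prod_singleton, ← mul_assoc]
    congr 1
    refine Commute.list_prod_right _ _ fun y hy => ?_
    obtain ⟨j, hj, rfl⟩ := List.mem_map.mp hy
    have hj := List.mem_range.mp hj
    exact Commute.det_sq fun y hy => (Commute.det_sq fun x hx =>
      (hcomm x hx (j + 1) (by lia) (by lia) y hy).symm).symm

/-- Under the RE relations for `K = [[α,β],[γ,δ]]` and the
`GL_q(2)` relations for each `T_l` (`1 ≤ l ≤ k-1`), with the appropriate mutual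
commutativity, the entries of `K^(k) = T_{k-1}⋯T_1 K T_1ᵗ⋯T_{k-1}ᵗ` satisfy
`α^(k) δ^(k) - q² β^(k) γ^(k) = (∏_{l=1}^{k-1} (det_q T_l)²) (αδ - q²βγ)`. -/
theorem RE_c2_factorizes {R A : Type} [CommRing R] [Ring A] [Algebra R A]
    (q : Rˣ) (k : ℕ) (hk : 2 ≤ k) (α β γ δ : A) (a b c d : ℕ → A)
    (hK : REREl q α β γ δ)
    (hT : ∀ l, 1 ≤ l → l ≤ k - 1 → GLq2Rel q (a l) (b l) (c l) (d l))
    (hTT : ∀ l l', 1 ≤ l → l ≤ k - 1 → 1 ≤ l' → l' ≤ k - 1 → l ≠ l' →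
      ∀ x ∈ ({a l, b l, c l, d l} : Set A), ∀ y ∈ ({a l', b l', c l', d l'} : Set A),
        Commute x y)
    (hTK : ∀ l, 1 ≤ l → l ≤ k - 1 →
      ∀ x ∈ ({a l, b l, c l, d l} : Set A), ∀ y ∈ ({α, β, γ, δ} : Set A),
        Commute x y) :
    KIter !![α, β; γ, δ] a b c d (k - 1) 0 0 * KIter !![α, β; γ, δ] a b c d (k - 1) 1 1
        - ((q : R) ^ 2) •
          (KIter !![α, β; γ, δ] a b c d (k - 1) 0 1 * KIter !![α, β; γ, δ] a b c d (k - 1) 1 0) =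
      ((List.range (k - 1)).map
          (fun j => (a (j + 1) * d (j + 1) - (q : R) • (b (j + 1) * c (j + 1))) ^ 2)).prod
        * (α * δ - ((q : R) ^ 2) • (β * γ)) := by
  have h := REREl.KIter (K := !![α, β; γ, δ]) (by simpa using hK) hT hTT
    (fun l h1 h2 x hx => by simpa [Fin.forall_fin_two, and_assoc] using hTK l h1 h2 x hx)
  simpa using h.2
end

section
/- Let F be a field, q, λ ∈ F with q ≠ 0, q² ≠ 1 and λ² = q − q⁻¹, and A an associative unital F-algebra. Suppose m, a, a⁺ ∈ A with m invertible satisfy the q-oscillator relations (m a m⁻¹ = q a, m a⁺ m⁻¹ = q⁻¹ a⁺, a a⁺ − a⁺ a = m²), suppose k, x₊, x₋ ∈ A with k invertible satisfy the su_q(2) relations (k x₊ k⁻¹ = q x₊, k x₋ k⁻¹ = q⁻¹ x₋, x₊ x₋ − x₋ x₊ = (q − q⁻¹)⁻¹ (k² − k⁻²)), and suppose each of m, a, a⁺ commutes with each of k, x₊, x₋. Define M = m k⁻¹, A' = a k + λ m x₋, A'⁺ = a⁺ k + λ m x₊ (the images of q^{−N}, A, A⁺ under the coaction φ(N) = N⊗1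 + 1⊗J, φ(A) = A⊗q^J + (q−q⁻¹)^{1/2} q^{−N}⊗X₋, φ(A⁺) = A⁺⊗q^J + (q−q⁻¹)^{1/2} q^{−N}⊗X₊). Then M is invertible and M, A', A'⁺ again satisfy the q-oscillator relations: M A' M⁻¹ = q A', M A'⁺ M⁻¹ = q⁻¹ A'⁺, and A' A'⁺ − A'⁺ A' = M². -/
/-- If `u` and `v` rescale `x` by `c` and `d` when moved past it, then `u * v` rescales it by
`c * d`. -/
theorem mul_smul_commute_left {F A : Type*} [Field F] [Ring A] [Algebra F A] {c d : F}
    {u v x : A} (hu : u * x = c • (x * u)) (hv : v * x = d • (x * v)) :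
    u * v * x = (c * d) • (x * (u * v)) := by
  rw [mul_assoc, hv, mul_smul_comm, ← mul_assoc, hu, smul_mul_assoc, smul_smul, mul_comm d c,
    mul_assoc]

/-- If `u` rescales `x` and `y` by `c` and `d` when moved past them, then it rescales `x * y` by
`c * d`. -/
theorem mul_smul_commute_right {F A : Type*} [Field F] [Ring A] [Algebra F A] {c d : F}
    {u x y : A} (hx : u * x = c • (x * u)) (hy : u * y = d • (y * u)) :
    u * (x * y) = (c * d) • (x * y * u) := by
  rw [← mul_assoc, hx, smul_mul_assoc, mul_assoc, hy, mul_smul_comm, smul_smul, mul_assoc]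

/-- If conjugation by a unit rescales `x` by `c`, conjugation by its inverse rescales it by
`c⁻¹`. -/
theorem inv_mul_eq_smul_of_mul_eq_smul {F A : Type*} [Field F] [Ring A] [Algebra F A] {c : F}
    (hc : c ≠ 0) {u : Aˣ} {x : A} (h : (u : A) * x = c • (x * u)) :
    ((u⁻¹ : Aˣ) : A) * x = c⁻¹ • (x * ((u⁻¹ : Aˣ) : A)) := by
  rw [Units.inv_mul_eq_iff_eq_mul, mul_smul_comm, ← mul_assoc, h, smul_mul_assoc,
    Units.mul_inv_cancel_right, smul_smul, inv_mul_cancel₀ hc, one_smul]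

/-- If `m` rescales `b` by `c`, `k` rescales `x` by `c⁻¹`, and `m`, `b` commute with `k`, `x` as
needed, then conjugation by `m k⁻¹` rescales `b k + l m x` by `c`. -/
theorem coaction_conj {F A : Type*} [Field F] [Ring A] [Algebra F A] {c l : F} (hc : c ≠ 0)
    {m k : Aˣ} {b x : A} (hb : (m : A) * b = c • (b * m)) (hx : (k : A) * x = c⁻¹ • (x * k))
    (hmk : Commute (m : A) k) (hmx : Commute (m : A) x) (hbk : Commute b (k : A)) :
    ((m * k⁻¹ : Aˣ) : A) * (b * (k : A) + l • ((m : A) * x)) * (((m * k⁻¹)⁻¹ : Aˣ) : A)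
      = c • (b * (k : A) + l • ((m : A) * x)) := by
  have one {y z : A} (h : Commute y z) : y * z = (1 : F) • (z * y) := by rw [one_smul, h.eq]
  have hx' := inv_mul_eq_smul_of_mul_eq_smul (inv_ne_zero hc) hx
  rw [inv_inv] at hx'
  have hkb := mul_smul_commute_right
    (mul_smul_commute_left hb (one hbk.symm.units_inv_left))
    (mul_smul_commute_left (one hmk) (one (Commute.refl (k : A)).units_inv_left))
  have hmx' := mul_smul_commute_right
    (mul_smul_commute_left (one (Commute.refl (m : A))) (one hmk.symm.units_inv_left))
    (mul_smul_commute_left (one hmx) hx')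
  simp only [mul_one, one_mul] at hkb hmx'
  rw [Units.mul_inv_eq_iff_eq_mul, Units.val_mul, mul_add, mul_smul_comm, hkb, hmx',
    smul_mul_assoc, add_mul, smul_mul_assoc, smul_add, smul_comm l c]

/-- The mixed terms of the coaction commute: if `m` rescales `b` and `k` rescales `x` by the same
scalar, and `m`, `b` commute with `k`, `x` as needed, then `b k` commutes with `m x`. -/
theorem coaction_cross_commute {F A : Type*} [Field F] [Ring A] [Algebra F A] {c : F}
    {m k b x : A} (hb : m * b = c • (b * m)) (hx : k * x = c • (x * k))
    (hmk : Commute m k) (hbx : Commute b x) :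
    Commute (b * k) (m * x) := by
  calc b * k * (m * x) = b * m * (k * x) := hmk.symm.mul_mul_mul_comm b x
    _ = m * b * (x * k) := by rw [hx, hb, mul_smul_comm, smul_mul_assoc]
    _ = m * x * (b * k) := hbx.mul_mul_mul_comm m k

/-- If `m, a, a⁺` satisfy the q-oscillator relations, `k, x₊, x₋`
satisfy the `su_q(2)` relations, the two triples mutually commute, and `λ² = q - q⁻¹`,
then `M = m k⁻¹` is invertible and `M`, `A' = a k + λ m x₋`, `A'⁺ = a⁺ k + λ m x₊`
again satisfy the q-oscillator relations. -/
theorem qOscillator_comodule {F A : Type} [Field F] [Ring A] [Algebra F A]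
    (q lam : F) (hq0 : q ≠ 0) (hq1 : q ^ 2 ≠ 1) (hlam : lam ^ 2 = q - q⁻¹)
    (m k : Aˣ) (a aPlus xPlus xMinus : A)
    (h1 : (m : A) * a * ((m⁻¹ : Aˣ) : A) = q • a)
    (h2 : (m : A) * aPlus * ((m⁻¹ : Aˣ) : A) = q⁻¹ • aPlus)
    (h3 : a * aPlus - aPlus * a = (m : A) ^ 2)
    (g1 : (k : A) * xPlus * ((k⁻¹ : Aˣ) : A) = q • xPlus)
    (g2 : (k : A) * xMinus * ((k⁻¹ : Aˣ) : A) = q⁻¹ • xMinus)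
    (g3 : xPlus * xMinus - xMinus * xPlus
      = (q - q⁻¹)⁻¹ • ((k : A) ^ 2 - ((k⁻¹ : Aˣ) : A) ^ 2))
    (hcomm : ∀ x ∈ ({(m : A), a, aPlus} : Set A),
      ∀ y ∈ ({(k : A), xPlus, xMinus} : Set A), Commute x y) :
    IsUnit ((m : A) * ((k⁻¹ : Aˣ) : A)) ∧
    (((m * k⁻¹ : Aˣ) : A) * (a * (k : A) + lam • ((m : A) * xMinus)) *
        (((m * k⁻¹)⁻¹ : Aˣ) : A)
      = q • (a * (k : A) + lam • ((m : A) * xMinus))) ∧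
    (((m * k⁻¹ : Aˣ) : A) * (aPlus * (k : A) + lam • ((m : A) * xPlus)) *
        (((m * k⁻¹)⁻¹ : Aˣ) : A)
      = q⁻¹ • (aPlus * (k : A) + lam • ((m : A) * xPlus))) ∧
    ((a * (k : A) + lam • ((m : A) * xMinus)) * (aPlus * (k : A) + lam • ((m : A) * xPlus))
        - (aPlus * (k : A) + lam • ((m : A) * xPlus)) * (a * (k : A) + lam • ((m : A) * xMinus))
      = ((m * k⁻¹ : Aˣ) : A) ^ 2) := by
  have hmk : Commute (m : A) k := hcomm _ (by simp) _ (by simp)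
  have hmp : Commute (m : A) xPlus := hcomm _ (by simp) _ (by simp)
  have hmm : Commute (m : A) xMinus := hcomm _ (by simp) _ (by simp)
  have hak : Commute a k := hcomm _ (by simp) _ (by simp)
  have hap : Commute a xPlus := hcomm _ (by simp) _ (by simp)
  have hpk : Commute aPlus k := hcomm _ (by simp) _ (by simp)
  have hpm : Commute aPlus xMinus := hcomm _ (by simp) _ (by simp)
  rw [Units.mul_inv_eq_iff_eq_mul, smul_mul_assoc] at h1 h2 g1 g2
  refine ⟨(m * k⁻¹).isUnit, coaction_conj hq0 h1 g2 hmk hmm hak,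
    coaction_conj (inv_ne_zero hq0) h2 (by rwa [inv_inv]) hmk hmp hpk, ?_⟩
  have hne : q - q⁻¹ ≠ 0 := fun h => hq1 <| by
    rw [sq]
    nth_rewrite 2 [sub_eq_zero.mp h]
    exact mul_inv_cancel₀ hq0
  have cross₁ := (coaction_cross_commute h1 g1 hmk hap).eq
  have cross₂ := (coaction_cross_commute h2 g2 hmk hpm).eq
  have diag₁ : a * (k : A) * (aPlus * k) - aPlus * k * (a * k) = (m : A) ^ 2 * (k : A) ^ 2 := by
    rw [hpk.symm.mul_mul_mul_comm, hak.symm.mul_mul_mul_comm, ← sub_mul, h3, sq (k : A)]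
  have diag₂ : (lam * lam) • ((m : A) * xMinus * (m * xPlus) - m * xPlus * (m * xMinus))
      = (m : A) ^ 2 * (((k⁻¹ : Aˣ) : A) ^ 2 - (k : A) ^ 2) := by
    rw [hmm.symm.mul_mul_mul_comm, hmp.symm.mul_mul_mul_comm, ← mul_sub,
      ← neg_sub (xPlus * xMinus), g3, ← sq, ← sq, hlam, mul_neg, mul_smul_comm, smul_neg, smul_smul,
      mul_inv_cancel₀ hne, one_smul, ← mul_neg, neg_sub]
  have hM : ((m * k⁻¹ : Aˣ) : A) ^ 2 = (m : A) ^ 2 * ((k⁻¹ : Aˣ) : A) ^ 2 := by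
    rw [Units.val_mul, hmk.units_inv_right.mul_pow]
  rw [hM]
  calc _ = (a * (k : A) * (aPlus * k) - aPlus * k * (a * k))
        + (lam * lam) • ((m : A) * xMinus * (m * xPlus) - m * xPlus * (m * xMinus)) := by
        simp only [add_mul, mul_add, smul_mul_assoc, mul_smul_comm, smul_sub, smul_add, smul_smul, cross₁,
          cross₂]
        abel
    _ = _ := by
        rw [diag₁, diag₂, ← mul_add, add_sub_cancel]
end

section
/- Let F be a field, q, λ ∈ F with q ≠ 0, q² ≠ 1 and λ² = q − q⁻¹, and A an associative unital F-algebra. Suppose m, a, a⁺ ∈ A with m invertible satisfy the q-oscillator relations (m a m⁻¹ = q a, m a⁺ m⁻¹ = q⁻¹ a⁺, a a⁺ − a⁺ a = m²), suppose k, x₊, x₋ ∈ A with k invertible satisfy the su_q(2) relations (k x₊ k⁻¹ = q x₊, k x₋ k⁻¹ = q⁻¹ x₋, x₊ x₋ − x₋ x₊ = (q − q⁻¹)⁻¹ (k² − k⁻²)), and suppose each of m, a, a⁺ commutes with each of k, x₊, x₋. Define the two-body Hamiltonian H^(2) = (a⁺ k + λ m x₊)(a k + λ m x₋) and M = m k⁻¹.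 Then H^(2) M = M H^(2) (conservation of the total excitation number N + J). -/
section QCommutation

variable {F A : Type*} [Field F] [Ring A] [Algebra F A]

theorem qComm_of_conj {u : Aˣ} {x : A} {c : F}
    (h : (u : A) * x * ((u⁻¹ : Aˣ) : A) = c • x) : (u : A) * x = c • (x * u) := by
  rw [← smul_mul_assoc, ← h, Units.inv_mul_cancel_right]

theorem qComm_inv_of_conj {u : Aˣ} {x : A} {c : F} (hc : c ≠ 0)
    (h : (u : A) * x * ((u⁻¹ : Aˣ) : A) = c • x) :
    ((u⁻¹ : Aˣ) : A) * x = c⁻¹ • (x * ((u⁻¹ : Aˣ) : A)) := by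
  have h' : x * ((u⁻¹ : Aˣ) : A) = c • (((u⁻¹ : Aˣ) : A) * x) := by
    rw [← mul_smul_comm, ← h, mul_assoc (u : A), Units.inv_mul_cancel_left]
  rw [h', smul_smul, inv_mul_cancel₀ hc, one_smul]

theorem qComm_mul_right {w x y : A} {c d : F} (hx : w * x = c • (x * w))
    (hy : w * y = d • (y * w)) : w * (x * y) = (c * d) • (x * y * w) := by
  rw [← mul_assoc, hx, smul_mul_assoc, mul_assoc, hy, mul_smul_comm, smul_smul, mul_assoc]

theorem qComm_mul_left {v w x : A} {c d : F} (hv : v * x = c • (x * v))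
    (hw : w * x = d • (x * w)) : v * w * x = (c * d) • (x * (v * w)) := by
  rw [mul_assoc, hw, mul_smul_comm, ← mul_assoc, hv, smul_mul_assoc, smul_smul, mul_assoc,
    mul_comm d]

theorem qComm_add_right {w x y : A} {c : F} (hx : w * x = c • (x * w))
    (hy : w * y = c • (y * w)) : w * (x + y) = c • ((x + y) * w) := by
  rw [mul_add, hx, hy, add_mul, smul_add]

theorem qComm_smul_right {w x : A} {c : F} (r : F) (hx : w * x = c • (x * w)) :
    w * (r • x) = c • (r • x * w) := by
  rw [mul_smul_comm, hx, smul_mul_assoc, smul_comm]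

theorem Commute.qComm {w x : A} (h : Commute w x) : w * x = (1 : F) • (x * w) := by
  rw [one_smul, h.eq]

end QCommutation

/-- With `m, a, a⁺` a q-oscillator triple, `k, x₊, x₋` an `su_q(2)`
triple, the two triples mutually commuting and `λ² = q - q⁻¹`, the two-body
Hamiltonian `H⁽²⁾ = (a⁺ k + λ m x₊)(a k + λ m x₋)` commutes with `M = m k⁻¹`
(conservation of the total excitation number `N + J`). -/
theorem qOscillator_H2_conserves_M {F A : Type} [Field F] [Ring A] [Algebra F A]
    (q lam : F) (hq0 : q ≠ 0) (hq1 : q ^ 2 ≠ 1) (hlam : lam ^ 2 = q - q⁻¹)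
    (m k : Aˣ) (a aPlus xPlus xMinus : A)
    (h1 : (m : A) * a * ((m⁻¹ : Aˣ) : A) = q • a)
    (h2 : (m : A) * aPlus * ((m⁻¹ : Aˣ) : A) = q⁻¹ • aPlus)
    (h3 : a * aPlus - aPlus * a = (m : A) ^ 2)
    (g1 : (k : A) * xPlus * ((k⁻¹ : Aˣ) : A) = q • xPlus)
    (g2 : (k : A) * xMinus * ((k⁻¹ : Aˣ) : A) = q⁻¹ • xMinus)
    (g3 : xPlus * xMinus - xMinus * xPlus
      = (q - q⁻¹)⁻¹ • ((k : A) ^ 2 - ((k⁻¹ : Aˣ) : A) ^ 2))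
    (hcomm : ∀ x ∈ ({(m : A), a, aPlus} : Set A),
      ∀ y ∈ ({(k : A), xPlus, xMinus} : Set A), Commute x y) :
    ((aPlus * (k : A) + lam • ((m : A) * xPlus)) *
        (a * (k : A) + lam • ((m : A) * xMinus))) *
        ((m : A) * ((k⁻¹ : Aˣ) : A))
      = ((m : A) * ((k⁻¹ : Aˣ) : A)) *
        ((aPlus * (k : A) + lam • ((m : A) * xPlus)) *
          (a * (k : A) + lam • ((m : A) * xMinus))) := by
  set w : A := (m : A) * ((k⁻¹ : Aˣ) : A) with hw
  have hmk : Commute (m : A) k := hcomm _ (by simp) _ (by simp)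
  have hak : Commute a (k : A) := hcomm _ (by simp) _ (by simp)
  have hpk : Commute aPlus (k : A) := hcomm _ (by simp) _ (by simp)
  have hmx : Commute (m : A) xPlus := hcomm _ (by simp) _ (by simp)
  have hmy : Commute (m : A) xMinus := hcomm _ (by simp) _ (by simp)
  have wk : w * k = (1 : F) • (k * w) :=
    (hmk.mul_left (Commute.refl (k : A)).units_inv_left).qComm
  have wm : w * m = (1 : F) • (m * w) :=
    ((Commute.refl (m : A)).mul_left hmk.symm.units_inv_left).qComm
  have wa : w * a = (q * 1) • (a * w) :=
    qComm_mul_left (qComm_of_conj h1) hak.symm.units_inv_left.qComm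
  have wp : w * aPlus = (q⁻¹ * 1) • (aPlus * w) :=
    qComm_mul_left (qComm_of_conj h2) hpk.symm.units_inv_left.qComm
  have wx : w * xPlus = (1 * q⁻¹) • (xPlus * w) :=
    qComm_mul_left hmx.qComm (qComm_inv_of_conj hq0 g1)
  have wy : w * xMinus = (1 * q⁻¹⁻¹) • (xMinus * w) :=
    qComm_mul_left hmy.qComm (qComm_inv_of_conj (inv_ne_zero hq0) g2)
  simp only [mul_one, one_mul, inv_inv] at wa wp wx wy
  have hak' := qComm_mul_right wa wk
  have hpk' := qComm_mul_right wp wk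
  have hmx' := qComm_mul_right wm wx
  have hmy' := qComm_mul_right wm wy
  simp only [mul_one, one_mul] at hak' hpk' hmx' hmy'
  have key := qComm_mul_right (qComm_add_right hpk' (qComm_smul_right lam hmx'))
    (qComm_add_right hak' (qComm_smul_right lam hmy'))
  rw [inv_mul_cancel₀ hq0, one_smul] at key
  exact key.symm
end

section
/- Fix z ∈ ℝ, z ≠ 0. Define smooth functions on U = {(q,p) ∈ ℝ² : pq ≠ 0} by N(q,p) = pq, A⁺(q,p) = p, and A(q,p) = (1/2)·((1 − e^{−2z pq})/(z pq))·q. Then with respect to the canonical Poisson bracket on ℝ² these functions satisfy the classical q-oscillator Poisson relations on U: {N, A} = −A, {N, A⁺} = A⁺, {A, A⁺} = e^{−2zN}, and moreover the Casimir function vanishes identically: A⁺·A − (1 − e^{−2zN})/(2z) = 0 on U. -/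
/-- The canonical Poisson bracket on `ℝ²` with coordinates `(q, p)`:
`{f,g} = (∂f/∂q)(∂g/∂p) − (∂f/∂p)(∂g/∂q)`. -/
noncomputable def poissonBracket2 (f g : ℝ × ℝ → ℝ) (x : ℝ × ℝ) : ℝ :=
  fderiv ℝ f x (1, 0) * fderiv ℝ g x (0, 1) -
    fderiv ℝ f x (0, 1) * fderiv ℝ g x (1, 0)

open ContinuousLinearMap in
theorem poissonBracket2_eq_of_hasFDerivAt {f g : ℝ × ℝ → ℝ} {x : ℝ × ℝ} {a b c d : ℝ}
    (hf : HasFDerivAt f (a • fst ℝ ℝ ℝ + b • snd ℝ ℝ ℝ) x)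
    (hg : HasFDerivAt g (c • fst ℝ ℝ ℝ + d • snd ℝ ℝ ℝ) x) :
    poissonBracket2 f g x = a * d - b * c := by
  simp [poissonBracket2, hf.fderiv, hg.fderiv]

open ContinuousLinearMap in
theorem hasFDerivAt_qOscillator_annihilation {z : ℝ} (hz : z ≠ 0) {x : ℝ × ℝ}
    (hx : x.2 * x.1 ≠ 0) :
    HasFDerivAt (fun y : ℝ × ℝ =>
        (1 / 2) * ((1 - Real.exp (-2 * z * (y.2 * y.1))) / (z * (y.2 * y.1))) * y.1)
      (Real.exp (-2 * z * (x.2 * x.1)) • fst ℝ ℝ ℝ +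
        (x.1 * Real.exp (-2 * z * (x.2 * x.1)) / x.2 -
          (1 - Real.exp (-2 * z * (x.2 * x.1))) / (2 * z * x.2 ^ 2)) • snd ℝ ℝ ℝ) x := by
  have h1 : x.1 ≠ 0 := right_ne_zero_of_mul hx
  have h2 : x.2 ≠ 0 := left_ne_zero_of_mul hx
  have hfst : HasFDerivAt (fun y : ℝ × ℝ => y.1) (fst ℝ ℝ ℝ) x := hasFDerivAt_fst
  have hsnd : HasFDerivAt (fun y : ℝ × ℝ => y.2) (snd ℝ ℝ ℝ) x := hasFDerivAt_snd
  have hmul := hsnd.mul hfst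
  have hexp : HasDerivAt (fun t : ℝ => 1 - Real.exp (-2 * z * t))
      (-(Real.exp (-2 * z * (x.2 * x.1)) * (-2 * z))) (x.2 * x.1) := by
    simpa using (((hasDerivAt_id (x.2 * x.1)).const_mul (-2 * z)).exp).const_sub 1
  have hden : HasDerivAt (fun t : ℝ => z * t) z (x.2 * x.1) := by
    simpa using (hasDerivAt_id (x.2 * x.1)).const_mul z
  have hquot := hexp.div hden (mul_ne_zero hz hx)
  have h := ((hquot.comp_hasFDerivAt x hmul).const_mul (1 / 2)).mul hfst
  refine h.congr_fderiv ?_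
  ext
  · simp
    field_simp
    ring
  · simp
    field_simp

/-- The functions `N = pq`, `A⁺ = p`,
`A = (1/2)·((1 − e^{−2zpq})/(zpq))·q` satisfy the classical q-oscillator Poisson
relations `{N,A} = −A`, `{N,A⁺} = A⁺`, `{A,A⁺} = e^{−2zN}` on `U = {pq ≠ 0}`, and the
Casimir `A⁺A − (1 − e^{−2zN})/(2z)` vanishes identically on `U`. -/
theorem classical_qOscillator_realization (z : ℝ) (hz : z ≠ 0)
    (N Aplus Afun : ℝ × ℝ → ℝ)
    (hN : ∀ x : ℝ × ℝ, N x = x.2 * x.1)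
    (hAplus : ∀ x : ℝ × ℝ, Aplus x = x.2)
    (hA : ∀ x : ℝ × ℝ, Afun x =
      (1 / 2) * ((1 - Real.exp (-2 * z * (x.2 * x.1))) / (z * (x.2 * x.1))) * x.1) :
    ∀ x : ℝ × ℝ, x.2 * x.1 ≠ 0 →
      poissonBracket2 N Afun x = -Afun x ∧
      poissonBracket2 N Aplus x = Aplus x ∧
      poissonBracket2 Afun Aplus x = Real.exp (-2 * z * N x) ∧
      Aplus x * Afun x - (1 - Real.exp (-2 * z * N x)) / (2 * z) = 0 := by
  obtain rfl : N = fun x => x.2 * x.1 := funext hN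
  obtain rfl : Aplus = fun x => x.2 := funext hAplus
  obtain rfl := funext hA
  intro x hx
  have h1 : x.1 ≠ 0 := right_ne_zero_of_mul hx
  have h2 : x.2 ≠ 0 := left_ne_zero_of_mul hx
  have hdA := hasFDerivAt_qOscillator_annihilation hz hx
  have hdN : HasFDerivAt (fun y : ℝ × ℝ => y.2 * y.1)
      (x.2 • ContinuousLinearMap.fst ℝ ℝ ℝ + x.1 • ContinuousLinearMap.snd ℝ ℝ ℝ) x :=
    hasFDerivAt_snd.mul hasFDerivAt_fst
  have hdP : HasFDerivAt (fun y : ℝ × ℝ => y.2)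
      ((0 : ℝ) • ContinuousLinearMap.fst ℝ ℝ ℝ + (1 : ℝ) • ContinuousLinearMap.snd ℝ ℝ ℝ) x := by
    simpa using hasFDerivAt_snd (𝕜 := ℝ) (p := x)
  refine ⟨?_, ?_, ?_, ?_⟩
  · rw [poissonBracket2_eq_of_hasFDerivAt hdN hdA]
    field_simp
    ring
  · rw [poissonBracket2_eq_of_hasFDerivAt hdN hdP]
    ring
  · rw [poissonBracket2_eq_of_hasFDerivAt hdA hdP]
    ring
  · field_simp
    ring
end

section
/- Fix real constants a, b. On the open set U = {(q₁,q₂,p₁,p₂) ∈ ℝ⁴ : q₁ + q₂ ≠ 0 and q₁ − q₂ ≠ 0}, define the smooth functions J₃ = p₁q₁ + p₂q₂, J₊ = (p₁² + p₂²)/2 + a/(q₁+q₂)² + b/(q₁−q₂)², J₋ = −(q₁² + q₂²)/2, N₃ = p₁q₂ + p₂q₁, N₊ = p₁p₂ + a/(q₁+q₂)² − b/(q₁−q₂)², N₋ = −q₁q₂. Then with respect to the canonical Poisson bracket on ℝ⁴ these functions close the so(2,2) Poisson algebra on U: {J₃,J±} = ±2J±, {N₃,N±} = ±2J±, {J₃,N±}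 = ±2N±, {N₃,J±} = ±2N±, {J₊,J₋} = J₃, {N₊,N₋} = J₃, {J₊,N₋} = N₃, {J₋,N₊} = −N₃, {J₃,N₃} = 0, {J₊,N₊} = 0, {J₋,N₋} = 0; and the Casimir functions take the constant values C₁ := (1/2)J₃² + (1/2)N₃² + 2J₊J₋ + 2N₊N₋ = −(a+b) and C₂ := (1/2)J₃N₃ + J₊N₋ + J₋N₊ = −(a−b)/2 on U. -/
/-- `ℝ⁴` with coordinates `(q₁, q₂, p₁, p₂)`. -/
abbrev Phase4 : Type := ℝ × ℝ × ℝ × ℝ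

/-- The canonical Poisson bracket on `ℝ⁴` with coordinates `(q₁, q₂, p₁, p₂)`. -/
noncomputable def pb4 (f g : Phase4 → ℝ) (x : Phase4) : ℝ :=
  fderiv ℝ f x (1, 0, 0, 0) * fderiv ℝ g x (0, 0, 1, 0) -
    fderiv ℝ f x (0, 0, 1, 0) * fderiv ℝ g x (1, 0, 0, 0) +
  (fderiv ℝ f x (0, 1, 0, 0) * fderiv ℝ g x (0, 0, 0, 1) -
    fderiv ℝ f x (0, 0, 0, 1) * fderiv ℝ g x (0, 1, 0, 0))

namespace SO22

variable (a b : ℝ)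

noncomputable def J3 : Phase4 → ℝ := fun x => x.2.2.1 * x.1 + x.2.2.2 * x.2.1
noncomputable def Jp : Phase4 → ℝ := fun x =>
  (x.2.2.1 ^ 2 + x.2.2.2 ^ 2) / 2 + a / (x.1 + x.2.1) ^ 2 + b / (x.1 - x.2.1) ^ 2
noncomputable def Jm : Phase4 → ℝ := fun x => -(x.1 ^ 2 + x.2.1 ^ 2) / 2
noncomputable def N3 : Phase4 → ℝ := fun x => x.2.2.1 * x.2.1 + x.2.2.2 * x.1
noncomputable def Np : Phase4 → ℝ := fun x =>
  x.2.2.1 * x.2.2.2 + a / (x.1 + x.2.1) ^ 2 - b / (x.1 - x.2.1) ^ 2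
noncomputable def Nm : Phase4 → ℝ := fun x => -(x.1 * x.2.1)

end SO22

namespace SO22

open ContinuousLinearMap in
/-- The covector on `ℝ⁴` with components `(c₁, c₂, c₃, c₄)`. -/
noncomputable def covector (c₁ c₂ c₃ c₄ : ℝ) : Phase4 →L[ℝ] ℝ :=
  c₁ • fst ℝ ℝ (ℝ × ℝ × ℝ) + c₂ • (fst ℝ ℝ _ ∘L snd ℝ ℝ (ℝ × ℝ × ℝ)) +
    c₃ • (fst ℝ ℝ ℝ ∘L snd ℝ ℝ (ℝ × ℝ) ∘L snd ℝ ℝ (ℝ × ℝ × ℝ)) +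
    c₄ • (snd ℝ ℝ ℝ ∘L snd ℝ ℝ (ℝ × ℝ) ∘L snd ℝ ℝ (ℝ × ℝ × ℝ))

theorem covector_apply (c₁ c₂ c₃ c₄ : ℝ) (v : Phase4) :
    covector c₁ c₂ c₃ c₄ v = c₁ * v.1 + c₂ * v.2.1 + c₃ * v.2.2.1 + c₄ * v.2.2.2 := by
  simp [covector]

theorem pb4_eq_of_hasFDerivAt {f g : Phase4 → ℝ} {x : Phase4} {c₁ c₂ c₃ c₄ d₁ d₂ d₃ d₄ : ℝ}
    (hf : HasFDerivAt f (covector c₁ c₂ c₃ c₄) x)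
    (hg : HasFDerivAt g (covector d₁ d₂ d₃ d₄) x) :
    pb4 f g x = c₁ * d₃ - c₃ * d₁ + (c₂ * d₄ - c₄ * d₂) := by
  simp [pb4, hf.fderiv, hg.fderiv, covector_apply]

theorem hasFDerivAt_q₁ (x : Phase4) :
    HasFDerivAt (fun y : Phase4 => y.1) (covector 1 0 0 0) x := by
  simpa [covector] using (hasFDerivAt_fst (𝕜 := ℝ) (p := x))

theorem hasFDerivAt_q₂ (x : Phase4) :
    HasFDerivAt (fun y : Phase4 => y.2.1) (covector 0 1 0 0) x := by
  simpa [covector] using (hasFDerivAt_snd (𝕜 := ℝ) (p := x)).fst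

theorem hasFDerivAt_p₁ (x : Phase4) :
    HasFDerivAt (fun y : Phase4 => y.2.2.1) (covector 0 0 1 0) x := by
  simpa [covector] using (hasFDerivAt_snd (𝕜 := ℝ) (p := x)).snd.fst

theorem hasFDerivAt_p₂ (x : Phase4) :
    HasFDerivAt (fun y : Phase4 => y.2.2.2) (covector 0 0 0 1) x := by
  simpa [covector] using (hasFDerivAt_snd (𝕜 := ℝ) (p := x)).snd.snd

theorem hasFDerivAt_div_sq {u : Phase4 → ℝ} {u' : Phase4 →L[ℝ] ℝ} {x : Phase4} (c : ℝ)
    (hu : HasFDerivAt u u' x) (hx : u x ≠ 0) :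
    HasFDerivAt (fun y => c / u y ^ 2) ((-2 * c / u x ^ 3) • u') x := by
  have h : HasDerivAt (fun t : ℝ => c / t ^ 2) (-2 * c / u x ^ 3) (u x) := by
    refine ((hasDerivAt_const (u x) c).div (hasDerivAt_pow 2 (u x))
      (pow_ne_zero 2 hx)).congr_deriv ?_
    field_simp
    simp
    ring
  exact h.comp_hasFDerivAt x hu

theorem hasFDerivAt_J3 (x : Phase4) :
    HasFDerivAt J3 (covector x.2.2.1 x.2.2.2 x.1 x.2.1) x := by
  refine (((hasFDerivAt_p₁ x).mul (hasFDerivAt_q₁ x)).add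
    ((hasFDerivAt_p₂ x).mul (hasFDerivAt_q₂ x))).congr_fderiv ?_
  refine ContinuousLinearMap.ext fun v => ?_
  simp [covector_apply]
  ring

theorem hasFDerivAt_N3 (x : Phase4) :
    HasFDerivAt N3 (covector x.2.2.2 x.2.2.1 x.2.1 x.1) x := by
  refine (((hasFDerivAt_p₁ x).mul (hasFDerivAt_q₂ x)).add
    ((hasFDerivAt_p₂ x).mul (hasFDerivAt_q₁ x))).congr_fderiv ?_
  refine ContinuousLinearMap.ext fun v => ?_
  simp [covector_apply]
  ring

theorem hasFDerivAt_Jm (x : Phase4) :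
    HasFDerivAt Jm (covector (-x.1) (-x.2.1) 0 0) x := by
  refine ((((hasFDerivAt_q₁ x).pow 2).add
    ((hasFDerivAt_q₂ x).pow 2)).neg.mul_const (2⁻¹ : ℝ)).congr_fderiv ?_
  refine ContinuousLinearMap.ext fun v => ?_
  simp [covector_apply]
  ring

theorem hasFDerivAt_Nm (x : Phase4) :
    HasFDerivAt Nm (covector (-x.2.1) (-x.1) 0 0) x := by
  refine ((hasFDerivAt_q₁ x).mul (hasFDerivAt_q₂ x)).neg.congr_fderiv ?_
  refine ContinuousLinearMap.ext fun v => ?_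
  simp [covector_apply]

theorem hasFDerivAt_Jp (a b : ℝ) {x : Phase4} (hs : x.1 + x.2.1 ≠ 0) (hd : x.1 - x.2.1 ≠ 0) :
    HasFDerivAt (Jp a b)
      (covector (-2 * a / (x.1 + x.2.1) ^ 3 + -2 * b / (x.1 - x.2.1) ^ 3)
        (-2 * a / (x.1 + x.2.1) ^ 3 - -2 * b / (x.1 - x.2.1) ^ 3) x.2.2.1 x.2.2.2) x := by
  refine ((((((hasFDerivAt_p₁ x).pow 2).add ((hasFDerivAt_p₂ x).pow 2)).mul_const (2⁻¹ : ℝ)).add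
    (hasFDerivAt_div_sq a ((hasFDerivAt_q₁ x).add (hasFDerivAt_q₂ x)) hs)).add
    (hasFDerivAt_div_sq b ((hasFDerivAt_q₁ x).sub (hasFDerivAt_q₂ x)) hd)).congr_fderiv ?_
  refine ContinuousLinearMap.ext fun v => ?_
  simp [covector_apply]
  ring

theorem hasFDerivAt_Np (a b : ℝ) {x : Phase4} (hs : x.1 + x.2.1 ≠ 0) (hd : x.1 - x.2.1 ≠ 0) :
    HasFDerivAt (Np a b)
      (covector (-2 * a / (x.1 + x.2.1) ^ 3 - -2 * b / (x.1 - x.2.1) ^ 3)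
        (-2 * a / (x.1 + x.2.1) ^ 3 + -2 * b / (x.1 - x.2.1) ^ 3) x.2.2.2 x.2.2.1) x := by
  refine ((((hasFDerivAt_p₁ x).mul (hasFDerivAt_p₂ x)).add
    (hasFDerivAt_div_sq a ((hasFDerivAt_q₁ x).add (hasFDerivAt_q₂ x)) hs)).sub
    (hasFDerivAt_div_sq b ((hasFDerivAt_q₁ x).sub (hasFDerivAt_q₂ x)) hd)).congr_fderiv ?_
  refine ContinuousLinearMap.ext fun v => ?_
  simp [covector_apply]
  ring

end SO22

open SO22 in
/-- The two-body Calogero-type functions close the `so(2,2)`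
Poisson algebra on `U = {q₁ + q₂ ≠ 0, q₁ − q₂ ≠ 0}`, and the two Casimir functions
take the constant values `−(a+b)` and `−(a−b)/2` there. -/
theorem so22_realization (a b : ℝ) :
    ∀ x : Phase4, x.1 + x.2.1 ≠ 0 → x.1 - x.2.1 ≠ 0 →
      pb4 (J3) (Jp a b) x = 2 * Jp a b x ∧
      pb4 (J3) (Jm) x = -2 * Jm x ∧
      pb4 (N3) (Jp a b) x = 2 * Np a b x ∧
      pb4 (N3) (Jm) x = -2 * Nm x ∧
      pb4 (J3) (Np a b) x = 2 * Np a b x ∧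
      pb4 (J3) (Nm) x = -2 * Nm x ∧
      pb4 (N3) (Np a b) x = 2 * Jp a b x ∧
      pb4 (N3) (Nm) x = -2 * Jm x ∧
      pb4 (Jp a b) (Jm) x = J3 x ∧
      pb4 (Np a b) (Nm) x = J3 x ∧
      pb4 (Jp a b) (Nm) x = N3 x ∧
      pb4 (Jm) (Np a b) x = -N3 x ∧
      pb4 (J3) (N3) x = 0 ∧
      pb4 (Jp a b) (Np a b) x = 0 ∧
      pb4 (Jm) (Nm) x = 0 ∧
      (1 / 2) * J3 x ^ 2 + (1 / 2) * N3 x ^ 2 + 2 * Jp a b x * Jm x +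
          2 * Np a b x * Nm x = -(a + b) ∧
      (1 / 2) * (J3 x * N3 x) + Jp a b x * Nm x + Jm x * Np a b x = -(a - b) / 2 := by
  intro x hs hd
  have hJ3 := hasFDerivAt_J3 x
  have hN3 := hasFDerivAt_N3 x
  have hJm := hasFDerivAt_Jm x
  have hNm := hasFDerivAt_Nm x
  have hJp := hasFDerivAt_Jp a b hs hd
  have hNp := hasFDerivAt_Np a b hs hd
  rw [pb4_eq_of_hasFDerivAt hJ3 hJp, pb4_eq_of_hasFDerivAt hJ3 hJm,
    pb4_eq_of_hasFDerivAt hN3 hJp, pb4_eq_of_hasFDerivAt hN3 hJm,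
    pb4_eq_of_hasFDerivAt hJ3 hNp, pb4_eq_of_hasFDerivAt hJ3 hNm,
    pb4_eq_of_hasFDerivAt hN3 hNp, pb4_eq_of_hasFDerivAt hN3 hNm,
    pb4_eq_of_hasFDerivAt hJp hJm, pb4_eq_of_hasFDerivAt hNp hNm,
    pb4_eq_of_hasFDerivAt hJp hNm, pb4_eq_of_hasFDerivAt hJm hNp,
    pb4_eq_of_hasFDerivAt hJ3 hN3, pb4_eq_of_hasFDerivAt hJp hNp,
    pb4_eq_of_hasFDerivAt hJm hNm]
  simp only [J3, N3, Jp, Jm, Np, Nm]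
  refine ⟨?_, ?_, ?_, ?_, ?_, ?_, ?_, ?_, ?_, ?_, ?_, ?_, ?_, ?_, ?_, ?_, ?_⟩ <;>
    field_simp <;> ring
end

section
/- Fix real constants a, b, c. On the open set U = {(q₁,q₂,q₃,p₁,p₂,p₃) ∈ ℝ⁶ : q₁ + q₂ ≠ 0, q₁ − q₂ ≠ 0, q₃ ≠ 0}, define the smooth two-particle coaction functions: 𝒥₃ = p₁q₁ + p₂q₂ + p₃q₃; 𝒥₊ = (p₁² + p₂²)/2 + a/(q₁+q₂)² + b/(q₁−q₂)² + p₃²/2 + c/q₃²; 𝒥₋ = −(q₁² + q₂²)/2 − q₃²/2; 𝒩₃ = p₁q₂ + p₂q₁ + p₃q₃; 𝒩₊ = p₁p₂ + a/(q₁+q₂)² − b/(q₁−q₂)² + p₃²/2 + c/q₃²; 𝒩₋ = −q₁q₂ − q₃²/2. Then the images of the two so(2,2) Casimir functions are functionally dependent: (1/2)𝒥₃𝒩₃ + 𝒥₊𝒩₋ + 𝒥₋𝒩₊ = (1/2)·((1/2)𝒥₃² + (1/2)𝒩₃² + 2𝒥₊𝒥₋ + 2𝒩₊𝒩₋) + b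 identically on U. -/
/-- `ℝ⁶` with coordinates `(q₁, q₂, q₃, p₁, p₂, p₃)`. -/
abbrev Phase6 : Type := ℝ × ℝ × ℝ × ℝ × ℝ × ℝ

namespace CoactSO22

variable (a b c : ℝ)

noncomputable def J3 : Phase6 → ℝ := fun x =>
  x.2.2.2.1 * x.1 + x.2.2.2.2.1 * x.2.1 + x.2.2.2.2.2 * x.2.2.1
noncomputable def Jp : Phase6 → ℝ := fun x =>
  (x.2.2.2.1 ^ 2 + x.2.2.2.2.1 ^ 2) / 2 + a / (x.1 + x.2.1) ^ 2 +
    b / (x.1 - x.2.1) ^ 2 + x.2.2.2.2.2 ^ 2 / 2 + c / x.2.2.1 ^ 2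
noncomputable def Jm : Phase6 → ℝ := fun x =>
  -(x.1 ^ 2 + x.2.1 ^ 2) / 2 - x.2.2.1 ^ 2 / 2
noncomputable def N3 : Phase6 → ℝ := fun x =>
  x.2.2.2.1 * x.2.1 + x.2.2.2.2.1 * x.1 + x.2.2.2.2.2 * x.2.2.1
noncomputable def Np : Phase6 → ℝ := fun x =>
  x.2.2.2.1 * x.2.2.2.2.1 + a / (x.1 + x.2.1) ^ 2 - b / (x.1 - x.2.1) ^ 2 +
    x.2.2.2.2.2 ^ 2 / 2 + c / x.2.2.1 ^ 2
noncomputable def Nm : Phase6 → ℝ := fun x =>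
  -(x.1 * x.2.1) - x.2.2.1 ^ 2 / 2

end CoactSO22

open CoactSO22 in
/-- Under the two-particle coaction realization, the images of the
two `so(2,2)` Casimir functions are functionally dependent:
`C₂⁽²⁾ = (1/2)·C₁⁽²⁾ + b` identically on `U`. -/
theorem coaction_casimirs_dependent (a b c : ℝ) :
    ∀ x : Phase6, x.1 + x.2.1 ≠ 0 → x.1 - x.2.1 ≠ 0 → x.2.2.1 ≠ 0 →
      (1 / 2) * (J3 x * N3 x) + Jp a b c x * Nm x +
          Jm x * Np a b c x =
        (1 / 2) * ((1 / 2) * J3 x ^ 2 + (1 / 2) * N3 x ^ 2 +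
            2 * Jp a b c x * Jm x + 2 * Np a b c x * Nm x) + b := by
  rintro ⟨q₁, q₂, q₃, p₁, p₂, p₃⟩ _ hminus _
  have hb : b / (q₁ - q₂) ^ 2 * (q₁ - q₂) ^ 2 = b :=
    div_mul_cancel₀ b (pow_ne_zero 2 hminus)
  simp only [J3, Jp, Jm, N3, Np, Nm]
  linear_combination hb
end

section
/- Fix real constants a, b, c. On the open set U = {(q₁,q₂,q₃,p₁,p₂,p₃) ∈ ℝ⁶ : q₁ + q₂ ≠ 0, q₁ − q₂ ≠ 0, q₃ ≠ 0}, define 𝒥₃ = p₁q₁ + p₂q₂ + p₃q₃; 𝒥₊ = (p₁² + p₂²)/2 + a/(q₁+q₂)² + b/(q₁−q₂)² + p₃²/2 + c/q₃²; 𝒥₋ = −(q₁² + q₂²)/2 − q₃²/2; 𝒩₃ = p₁q₂ + p₂q₁ + p₃q₃; 𝒩₊ = p₁p₂ + a/(q₁+q₂)² − b/(q₁−q₂)² + p₃²/2 + c/q₃²; 𝒩₋ = −q₁q₂ − q₃²/2; and C₁^(2) = (1/2)𝒥₃² + (1/2)𝒩₃² + 2𝒥₊𝒥₋ + 2𝒩₊𝒩₋.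 Then the three functions C₁^(2), 𝒥₊, 𝒩₊ are pairwise in involution with respect to the canonical Poisson bracket on ℝ⁶: {C₁^(2), 𝒥₊} = 0, {C₁^(2), 𝒩₊} = 0 and {𝒥₊, 𝒩₊} = 0 on U (so 𝒥₊ is a completely integrable three-body Hamiltonian). -/
/-- The canonical Poisson bracket on `ℝ⁶` with coordinates `(q₁, q₂, q₃, p₁, p₂, p₃)`. -/
noncomputable def pb6 (f g : Phase6 → ℝ) (x : Phase6) : ℝ :=
  fderiv ℝ f x (1, 0, 0, 0, 0, 0) * fderiv ℝ g x (0, 0, 0, 1, 0, 0) -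
    fderiv ℝ f x (0, 0, 0, 1, 0, 0) * fderiv ℝ g x (1, 0, 0, 0, 0, 0) +
  (fderiv ℝ f x (0, 1, 0, 0, 0, 0) * fderiv ℝ g x (0, 0, 0, 0, 1, 0) -
    fderiv ℝ f x (0, 0, 0, 0, 1, 0) * fderiv ℝ g x (0, 1, 0, 0, 0, 0)) +
  (fderiv ℝ f x (0, 0, 1, 0, 0, 0) * fderiv ℝ g x (0, 0, 0, 0, 0, 1) -
    fderiv ℝ f x (0, 0, 0, 0, 0, 1) * fderiv ℝ g x (0, 0, 1, 0, 0, 0))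

namespace CoactSO22

variable (a b c : ℝ)

/-- The image of the first `so(2,2)` Casimir under the coaction, in the
three-particle symplectic realization. -/
noncomputable def C1 : Phase6 → ℝ := fun x =>
  (1 / 2) * J3 x ^ 2 + (1 / 2) * N3 x ^ 2 + 2 * Jp a b c x * Jm x +
    2 * Np a b c x * Nm x

end CoactSO22

namespace CoactSO22

/-- The linear functional on `ℝ⁶` with the given coefficients. -/
noncomputable def covector (u₁ u₂ u₃ v₁ v₂ v₃ : ℝ) : Phase6 →L[ℝ] ℝ :=
  LinearMap.toContinuousLinearMap
    { toFun := fun x => u₁ * x.1 + u₂ * x.2.1 + u₃ * x.2.2.1 + v₁ * x.2.2.2.1 +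
        v₂ * x.2.2.2.2.1 + v₃ * x.2.2.2.2.2
      map_add' := fun x y => by simp only [Prod.fst_add, Prod.snd_add]; ring
      map_smul' := fun r x => by
        simp only [Prod.smul_fst, Prod.smul_snd, smul_eq_mul, RingHom.id_apply]; ring }

lemma covector_apply (u₁ u₂ u₃ v₁ v₂ v₃ : ℝ) (x : Phase6) :
    covector u₁ u₂ u₃ v₁ v₂ v₃ x = u₁ * x.1 + u₂ * x.2.1 + u₃ * x.2.2.1 + v₁ * x.2.2.2.1 +
      v₂ * x.2.2.2.2.1 + v₃ * x.2.2.2.2.2 := rfl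

lemma hasFDerivAt_q₁ (x : Phase6) :
    HasFDerivAt (fun x : Phase6 => x.1) (covector 1 0 0 0 0 0) x := by
  convert (covector 1 0 0 0 0 0).hasFDerivAt using 1
  ext y
  simp [covector_apply]

lemma hasFDerivAt_q₂ (x : Phase6) :
    HasFDerivAt (fun x : Phase6 => x.2.1) (covector 0 1 0 0 0 0) x := by
  convert (covector 0 1 0 0 0 0).hasFDerivAt using 1
  ext y
  simp [covector_apply]

lemma hasFDerivAt_q₃ (x : Phase6) :
    HasFDerivAt (fun x : Phase6 => x.2.2.1) (covector 0 0 1 0 0 0) x := by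
  convert (covector 0 0 1 0 0 0).hasFDerivAt using 1
  ext y
  simp [covector_apply]

lemma hasFDerivAt_p₁ (x : Phase6) :
    HasFDerivAt (fun x : Phase6 => x.2.2.2.1) (covector 0 0 0 1 0 0) x := by
  convert (covector 0 0 0 1 0 0).hasFDerivAt using 1
  ext y
  simp [covector_apply]

lemma hasFDerivAt_p₂ (x : Phase6) :
    HasFDerivAt (fun x : Phase6 => x.2.2.2.2.1) (covector 0 0 0 0 1 0) x := by
  convert (covector 0 0 0 0 1 0).hasFDerivAt using 1
  ext y
  simp [covector_apply]

lemma hasFDerivAt_p₃ (x : Phase6) :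
    HasFDerivAt (fun x : Phase6 => x.2.2.2.2.2) (covector 0 0 0 0 0 1) x := by
  convert (covector 0 0 0 0 0 1).hasFDerivAt using 1
  ext y
  simp [covector_apply]

lemma hasFDerivAt_of_eq {f g : Phase6 → ℝ} {f' g' : Phase6 →L[ℝ] ℝ} {x : Phase6}
    (hf : HasFDerivAt f f' x) (h : ∀ y, g y = f y) (h' : ∀ y, g' y = f' y) :
    HasFDerivAt g g' x := by
  rw [funext h, ContinuousLinearMap.ext h']
  exact hf

lemma hasFDerivAt_sq {f : Phase6 → ℝ} {f' : Phase6 →L[ℝ] ℝ} {x : Phase6}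
    (hf : HasFDerivAt f f' x) :
    HasFDerivAt (fun y => f y ^ 2) ((2 * f x) • f') x := by
  refine hasFDerivAt_of_eq (hf.fun_mul hf) (fun y => sq (f y)) fun y => ?_
  simp only [add_apply, smul_apply, smul_eq_mul]
  ring

lemma hasFDerivAt_const_div_sq {f : Phase6 → ℝ} {f' : Phase6 →L[ℝ] ℝ} {x : Phase6}
    (k : ℝ) (hf : HasFDerivAt f f' x) (h : f x ≠ 0) :
    HasFDerivAt (fun y => k / f y ^ 2) ((-2 * k / f x ^ 3) • f') x := by
  have hd : HasDerivAt (fun t : ℝ => k / t ^ 2) (-2 * k / f x ^ 3) (f x) := by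
    refine ((hasDerivAt_const (f x) k).fun_div (hasDerivAt_pow 2 (f x))
      (pow_ne_zero 2 h)).congr_deriv ?_
    push_cast
    field_simp
    ring
  exact hd.comp_hasFDerivAt x hf

lemma hasFDerivAt_J3 (x : Phase6) :
    HasFDerivAt J3 (covector x.2.2.2.1 x.2.2.2.2.1 x.2.2.2.2.2
      x.1 x.2.1 x.2.2.1) x := by
  refine hasFDerivAt_of_eq
    ((((hasFDerivAt_p₁ x).fun_mul (hasFDerivAt_q₁ x)).fun_add
      ((hasFDerivAt_p₂ x).fun_mul (hasFDerivAt_q₂ x))).fun_add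
    ((hasFDerivAt_p₃ x).fun_mul (hasFDerivAt_q₃ x))) (fun y => ?_) fun y => ?_
  · simp only [J3]
  · simp only [add_apply, smul_apply, smul_eq_mul, covector_apply]
    ring

lemma hasFDerivAt_N3 (x : Phase6) :
    HasFDerivAt N3 (covector x.2.2.2.2.1 x.2.2.2.1 x.2.2.2.2.2
      x.2.1 x.1 x.2.2.1) x := by
  refine hasFDerivAt_of_eq
    ((((hasFDerivAt_p₁ x).fun_mul (hasFDerivAt_q₂ x)).fun_add
      ((hasFDerivAt_p₂ x).fun_mul (hasFDerivAt_q₁ x))).fun_add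
    ((hasFDerivAt_p₃ x).fun_mul (hasFDerivAt_q₃ x))) (fun y => ?_) fun y => ?_
  · simp only [N3]
  · simp only [add_apply, smul_apply, smul_eq_mul, covector_apply]
    ring

lemma hasFDerivAt_Jm (x : Phase6) :
    HasFDerivAt Jm (covector (-x.1) (-x.2.1) (-x.2.2.1)
      0 0 0) x := by
  refine hasFDerivAt_of_eq
    (((hasFDerivAt_sq (hasFDerivAt_q₁ x)).fun_add
      (hasFDerivAt_sq (hasFDerivAt_q₂ x))).fun_neg.mul_const (1 / 2) |>.fun_sub
    ((hasFDerivAt_sq (hasFDerivAt_q₃ x)).mul_const (1 / 2))) (fun y => ?_) fun y => ?_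
  · simp only [Jm]
    ring
  · simp only [add_apply, sub_apply, neg_apply, smul_apply, smul_eq_mul, covector_apply]
    ring

lemma hasFDerivAt_Nm (x : Phase6) :
    HasFDerivAt Nm (covector (-x.2.1) (-x.1) (-x.2.2.1)
      0 0 0) x := by
  refine hasFDerivAt_of_eq
    (((hasFDerivAt_q₁ x).fun_mul (hasFDerivAt_q₂ x)).fun_neg.fun_sub
    ((hasFDerivAt_sq (hasFDerivAt_q₃ x)).mul_const (1 / 2))) (fun y => ?_) fun y => ?_
  · simp only [Nm]
    ring
  · simp only [add_apply, sub_apply, neg_apply, smul_apply, smul_eq_mul, covector_apply]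
    ring

lemma hasFDerivAt_Jp (a b c : ℝ) {x : Phase6} (h₁ : x.1 + x.2.1 ≠ 0)
    (h₂ : x.1 - x.2.1 ≠ 0) (h₃ : x.2.2.1 ≠ 0) :
    HasFDerivAt (Jp a b c) (covector
      (-(2 * a / (x.1 + x.2.1) ^ 3) - 2 * b / (x.1 - x.2.1) ^ 3)
      (-(2 * a / (x.1 + x.2.1) ^ 3) + 2 * b / (x.1 - x.2.1) ^ 3)
      (-(2 * c / x.2.2.1 ^ 3))
      x.2.2.2.1 x.2.2.2.2.1 x.2.2.2.2.2) x := by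
  refine hasFDerivAt_of_eq
    ((((((hasFDerivAt_sq (hasFDerivAt_p₁ x)).fun_add
      (hasFDerivAt_sq (hasFDerivAt_p₂ x))).mul_const (1 / 2)).fun_add
    (hasFDerivAt_const_div_sq a ((hasFDerivAt_q₁ x).fun_add (hasFDerivAt_q₂ x)) h₁)).fun_add
    (hasFDerivAt_const_div_sq b ((hasFDerivAt_q₁ x).fun_sub (hasFDerivAt_q₂ x)) h₂)).fun_add
    ((hasFDerivAt_sq (hasFDerivAt_p₃ x)).mul_const (1 / 2)) |>.fun_add
    (hasFDerivAt_const_div_sq c (hasFDerivAt_q₃ x) h₃)) (fun y => ?_) fun y => ?_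
  · simp only [Jp]
    ring
  · simp only [add_apply, sub_apply, smul_apply, smul_eq_mul, covector_apply]
    ring

lemma hasFDerivAt_Np (a b c : ℝ) {x : Phase6} (h₁ : x.1 + x.2.1 ≠ 0)
    (h₂ : x.1 - x.2.1 ≠ 0) (h₃ : x.2.2.1 ≠ 0) :
    HasFDerivAt (Np a b c) (covector
      (-(2 * a / (x.1 + x.2.1) ^ 3) + 2 * b / (x.1 - x.2.1) ^ 3)
      (-(2 * a / (x.1 + x.2.1) ^ 3) - 2 * b / (x.1 - x.2.1) ^ 3)
      (-(2 * c / x.2.2.1 ^ 3))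
      x.2.2.2.2.1 x.2.2.2.1 x.2.2.2.2.2) x := by
  refine hasFDerivAt_of_eq
    (((((hasFDerivAt_p₁ x).fun_mul (hasFDerivAt_p₂ x)).fun_add
    (hasFDerivAt_const_div_sq a ((hasFDerivAt_q₁ x).fun_add (hasFDerivAt_q₂ x)) h₁)).fun_sub
    (hasFDerivAt_const_div_sq b ((hasFDerivAt_q₁ x).fun_sub (hasFDerivAt_q₂ x)) h₂)).fun_add
    ((hasFDerivAt_sq (hasFDerivAt_p₃ x)).mul_const (1 / 2)) |>.fun_add
    (hasFDerivAt_const_div_sq c (hasFDerivAt_q₃ x) h₃)) (fun y => ?_) fun y => ?_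
  · simp only [Np]
    ring
  · simp only [add_apply, sub_apply, smul_apply, smul_eq_mul, covector_apply]
    ring

lemma hasFDerivAt_C1 (a b c : ℝ) {x : Phase6} {jp np : Phase6 →L[ℝ] ℝ}
    (hj : HasFDerivAt (Jp a b c) jp x) (hn : HasFDerivAt (Np a b c) np x) :
    HasFDerivAt (C1 a b c)
      (J3 x • fderiv ℝ J3 x + N3 x • fderiv ℝ N3 x +
        (2 * Jp a b c x) • fderiv ℝ Jm x + (2 * Jm x) • jp +
        (2 * Np a b c x) • fderiv ℝ Nm x + (2 * Nm x) • np) x := by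
  have h₁ := (hasFDerivAt_J3 x).differentiableAt.hasFDerivAt
  have h₂ := (hasFDerivAt_N3 x).differentiableAt.hasFDerivAt
  have h₃ := (hasFDerivAt_Jm x).differentiableAt.hasFDerivAt
  have h₄ := (hasFDerivAt_Nm x).differentiableAt.hasFDerivAt
  refine hasFDerivAt_of_eq (((((hasFDerivAt_sq h₁).const_mul (1 / 2)).fun_add
      ((hasFDerivAt_sq h₂).const_mul (1 / 2))).fun_add
    ((hj.const_mul 2).fun_mul h₃)).fun_add ((hn.const_mul 2).fun_mul h₄))
    (fun y => rfl) fun y => ?_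
  simp only [add_apply, smul_apply, smul_eq_mul]
  ring

end CoactSO22

open CoactSO22 in
/-- The three functions `C₁⁽²⁾`, `𝒥₊`, `𝒩₊` are pairwise in
involution on `U` with respect to the canonical Poisson bracket on `ℝ⁶`. -/
theorem coaction_three_body_integrable (a b c : ℝ) :
    ∀ x : Phase6, x.1 + x.2.1 ≠ 0 → x.1 - x.2.1 ≠ 0 → x.2.2.1 ≠ 0 →
      pb6 (C1 a b c) (Jp a b c) x = 0 ∧
      pb6 (C1 a b c) (Np a b c) x = 0 ∧
      pb6 (Jp a b c) (Np a b c) x = 0 := by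
  intro x h₁ h₂ h₃
  have hj := hasFDerivAt_Jp a b c h₁ h₂ h₃
  have hn := hasFDerivAt_Np a b c h₁ h₂ h₃
  have hC := hasFDerivAt_C1 a b c hj hn
  refine ⟨?_, ?_, ?_⟩
  all_goals
    simp only [pb6, hC.fderiv, hj.fderiv, hn.fderiv, (hasFDerivAt_J3 x).fderiv,
      (hasFDerivAt_N3 x).fderiv, (hasFDerivAt_Jm x).fderiv, (hasFDerivAt_Nm x).fderiv,
      add_apply, smul_apply, smul_eq_mul,
      covector_apply, J3, N3, Jp, Np, Jm, Nm, mul_zero, mul_one, zero_add, add_zero]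
    field_simp
    ring
end

section
/- Fix real constants σ, λ₁, λ₂. On the open set U = {(q₁,q₂,p₁,p₂) ∈ ℝ⁴ : 1 + σλ₂p₂ ≠ 0}, set D₁' = −p₁q₁ + λ₁²/2 and define: 𝓜 = λ₁² + λ₂²; 𝓗 = p₂²/2 + (p₁²/2)(1 + σλ₂p₂)²; 𝓓 = −p₂q₂ − p₁q₁/(1 + σλ₂p₂) − (λ₁²/2)·σλ₂p₂/(1 + σλ₂p₂); 𝓒 = q₂²/2 + (q₁²/2)/(1 + σλ₂p₂)² + σD₁'·λ₂q₂/(1 + σλ₂p₂) + (σ²/2)(D₁')²·λ₂²/(1 + σλ₂p₂)²; 𝓟 = λ₂p₂ + λ₁p₁(1 + σλ₂p₂); 𝓚 = λ₂q₂ + λ₁q₁/(1 + σλ₂p₂) + σD₁'·λ₂²/(1 + σλ₂p₂). Then with respect to the canonical Poisson bracket on ℝ⁴ these six functions satisfy the Schrödinger Poisson algebra relations on U: {𝓓,𝓟} = −𝓟, {𝓓,𝓚} = 𝓚, {𝓚,𝓟} = 𝓜, {𝓓,𝓗} = −2𝓗, {𝓓,𝓒} = 2𝓒, {𝓗,𝓒}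 = 𝓓, {𝓗,𝓟} = 0, {𝓟,𝓒} = −𝓚, {𝓚,𝓗} = 𝓟, {𝓚,𝓒} = 0, and 𝓜 Poisson-commutes with all of them. -/
namespace SchrodSigma

variable (sig l1 l2 : ℝ)

/-- `D₁' = −p₁q₁ + λ₁²/2`. -/
noncomputable def D1' : Phase4 → ℝ := fun x => -(x.2.2.1 * x.1) + l1 ^ 2 / 2

noncomputable def M : Phase4 → ℝ := fun _ => l1 ^ 2 + l2 ^ 2
noncomputable def H : Phase4 → ℝ := fun x =>
  x.2.2.2 ^ 2 / 2 + (x.2.2.1 ^ 2 / 2) * (1 + sig * l2 * x.2.2.2) ^ 2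
noncomputable def D : Phase4 → ℝ := fun x =>
  -(x.2.2.2 * x.2.1) - x.2.2.1 * x.1 / (1 + sig * l2 * x.2.2.2) -
    (l1 ^ 2 / 2) * (sig * l2 * x.2.2.2 / (1 + sig * l2 * x.2.2.2))
noncomputable def C : Phase4 → ℝ := fun x =>
  x.2.1 ^ 2 / 2 + (x.1 ^ 2 / 2) / (1 + sig * l2 * x.2.2.2) ^ 2 +
    sig * D1' l1 x * (l2 * x.2.1 / (1 + sig * l2 * x.2.2.2)) +
    (sig ^ 2 / 2) * (D1' l1 x) ^ 2 * (l2 ^ 2 / (1 + sig * l2 * x.2.2.2) ^ 2)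
noncomputable def P : Phase4 → ℝ := fun x =>
  l2 * x.2.2.2 + l1 * x.2.2.1 * (1 + sig * l2 * x.2.2.2)
noncomputable def K : Phase4 → ℝ := fun x =>
  l2 * x.2.1 + l1 * x.1 / (1 + sig * l2 * x.2.2.2) +
    sig * D1' l1 x * (l2 ^ 2 / (1 + sig * l2 * x.2.2.2))

end SchrodSigma

/-- `f` is differentiable at `x` with partial derivatives `a`, `b`, `c`, `d` with respect to
`q₁`, `q₂`, `p₁`, `p₂`. -/
structure HasPartials (f : Phase4 → ℝ) (x : Phase4) (a b c d : ℝ) : Prop where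
  differentiableAt : DifferentiableAt ℝ f x
  fderiv_q₁ : fderiv ℝ f x (1, 0, 0, 0) = a
  fderiv_q₂ : fderiv ℝ f x (0, 1, 0, 0) = b
  fderiv_p₁ : fderiv ℝ f x (0, 0, 1, 0) = c
  fderiv_p₂ : fderiv ℝ f x (0, 0, 0, 1) = d

namespace HasPartials

variable {f g : Phase4 → ℝ} {x : Phase4} {a b c d a' b' c' d' : ℝ}

theorem of_hasFDerivAt {f' : Phase4 →L[ℝ] ℝ} (h : HasFDerivAt f f' x) :
    HasPartials f x (f' (1, 0, 0, 0)) (f' (0, 1, 0, 0)) (f' (0, 0, 1, 0)) (f' (0, 0, 0, 1)) := by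
  refine ⟨h.differentiableAt, ?_, ?_, ?_, ?_⟩ <;> rw [h.fderiv]

theorem const (r : ℝ) : HasPartials (fun _ => r) x 0 0 0 0 := by
  simpa using of_hasFDerivAt (hasFDerivAt_const r x)

theorem q₁ : HasPartials (fun y => y.1) x 1 0 0 0 := by
  simpa using of_hasFDerivAt (hasFDerivAt_fst (𝕜 := ℝ) (p := x))

theorem q₂ : HasPartials (fun y => y.2.1) x 0 1 0 0 := by
  simpa using of_hasFDerivAt (hasFDerivAt_snd (𝕜 := ℝ) (p := x)).fst

theorem p₁ : HasPartials (fun y => y.2.2.1) x 0 0 1 0 := by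
  simpa using of_hasFDerivAt (hasFDerivAt_snd (𝕜 := ℝ) (p := x)).snd.fst

theorem p₂ : HasPartials (fun y => y.2.2.2) x 0 0 0 1 := by
  simpa using of_hasFDerivAt (hasFDerivAt_snd (𝕜 := ℝ) (p := x)).snd.snd

theorem add (hf : HasPartials f x a b c d) (hg : HasPartials g x a' b' c' d') :
    HasPartials (fun y => f y + g y) x (a + a') (b + b') (c + c') (d + d') := by
  simpa [hf.fderiv_q₁, hf.fderiv_q₂, hf.fderiv_p₁, hf.fderiv_p₂,
    hg.fderiv_q₁, hg.fderiv_q₂, hg.fderiv_p₁, hg.fderiv_p₂] using of_hasFDerivAt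
      (hf.differentiableAt.hasFDerivAt.fun_add hg.differentiableAt.hasFDerivAt)

theorem sub (hf : HasPartials f x a b c d) (hg : HasPartials g x a' b' c' d') :
    HasPartials (fun y => f y - g y) x (a - a') (b - b') (c - c') (d - d') := by
  simpa [hf.fderiv_q₁, hf.fderiv_q₂, hf.fderiv_p₁, hf.fderiv_p₂,
    hg.fderiv_q₁, hg.fderiv_q₂, hg.fderiv_p₁, hg.fderiv_p₂] using of_hasFDerivAt
      (hf.differentiableAt.hasFDerivAt.fun_sub hg.differentiableAt.hasFDerivAt)

theorem neg (hf : HasPartials f x a b c d) :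
    HasPartials (fun y => -f y) x (-a) (-b) (-c) (-d) := by
  simpa [hf.fderiv_q₁, hf.fderiv_q₂, hf.fderiv_p₁, hf.fderiv_p₂] using
    of_hasFDerivAt hf.differentiableAt.hasFDerivAt.fun_neg

theorem mul (hf : HasPartials f x a b c d) (hg : HasPartials g x a' b' c' d') :
    HasPartials (fun y => f y * g y) x (f x * a' + g x * a) (f x * b' + g x * b)
      (f x * c' + g x * c) (f x * d' + g x * d) := by
  simpa [hf.fderiv_q₁, hf.fderiv_q₂, hf.fderiv_p₁, hf.fderiv_p₂,
    hg.fderiv_q₁, hg.fderiv_q₂, hg.fderiv_p₁, hg.fderiv_p₂] using of_hasFDerivAt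
      (hf.differentiableAt.hasFDerivAt.fun_mul hg.differentiableAt.hasFDerivAt)

theorem sq (hf : HasPartials f x a b c d) :
    HasPartials (fun y => f y ^ 2) x (f x * a + f x * a) (f x * b + f x * b)
      (f x * c + f x * c) (f x * d + f x * d) := by
  simpa only [pow_two] using hf.mul hf

theorem inv (hf : HasPartials f x a b c d) (hx : f x ≠ 0) :
    HasPartials (fun y => (f y)⁻¹) x (-(f x ^ 2)⁻¹ * a) (-(f x ^ 2)⁻¹ * b)
      (-(f x ^ 2)⁻¹ * c) (-(f x ^ 2)⁻¹ * d) := by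
  simpa [hf.fderiv_q₁, hf.fderiv_q₂, hf.fderiv_p₁, hf.fderiv_p₂] using
    of_hasFDerivAt (f := fun y => (f y)⁻¹) ((hasDerivAt_inv hx).comp_hasFDerivAt x hf.differentiableAt.hasFDerivAt)

theorem div (hf : HasPartials f x a b c d) (hg : HasPartials g x a' b' c' d') (hx : g x ≠ 0) :
    HasPartials (fun y => f y / g y) x
      (f x * (-(g x ^ 2)⁻¹ * a') + (g x)⁻¹ * a) (f x * (-(g x ^ 2)⁻¹ * b') + (g x)⁻¹ * b)
      (f x * (-(g x ^ 2)⁻¹ * c') + (g x)⁻¹ * c) (f x * (-(g x ^ 2)⁻¹ * d') + (g x)⁻¹ * d) := by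
  simpa only [div_eq_mul_inv] using hf.mul (hg.inv hx)

theorem pb4_eq (hf : HasPartials f x a b c d) (hg : HasPartials g x a' b' c' d') :
    pb4 f g x = a * c' - c * a' + (b * d' - d * b') := by
  rw [pb4, hf.fderiv_q₁, hf.fderiv_q₂, hf.fderiv_p₁, hf.fderiv_p₂,
    hg.fderiv_q₁, hg.fderiv_q₂, hg.fderiv_p₁, hg.fderiv_p₂]

end HasPartials

open SchrodSigma in
/-- The two-particle symplectic realization of the σ-deformed
('space-type') coproduct of the Schrödinger algebra satisfies the Schrödinger
Poisson algebra relations on `U = {1 + σλ₂p₂ ≠ 0}`. -/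
theorem schrodinger_sigma_comodule (sig l1 l2 : ℝ) :
    ∀ x : Phase4, 1 + sig * l2 * x.2.2.2 ≠ 0 →
      pb4 (D sig l1 l2) (P sig l1 l2) x = -P sig l1 l2 x ∧
      pb4 (D sig l1 l2) (K sig l1 l2) x = K sig l1 l2 x ∧
      pb4 (K sig l1 l2) (P sig l1 l2) x = M l1 l2 x ∧
      pb4 (D sig l1 l2) (H sig l2) x = -2 * H sig l2 x ∧
      pb4 (D sig l1 l2) (C sig l1 l2) x = 2 * C sig l1 l2 x ∧
      pb4 (H sig l2) (C sig l1 l2) x = D sig l1 l2 x ∧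
      pb4 (H sig l2) (P sig l1 l2) x = 0 ∧
      pb4 (P sig l1 l2) (C sig l1 l2) x = -K sig l1 l2 x ∧
      pb4 (K sig l1 l2) (H sig l2) x = P sig l1 l2 x ∧
      pb4 (K sig l1 l2) (C sig l1 l2) x = 0 ∧
      pb4 (M l1 l2) (D sig l1 l2) x = 0 ∧
      pb4 (M l1 l2) (H sig l2) x = 0 ∧
      pb4 (M l1 l2) (C sig l1 l2) x = 0 ∧
      pb4 (M l1 l2) (K sig l1 l2) x = 0 ∧
      pb4 (M l1 l2) (P sig l1 l2) x = 0 := by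
  intro x hx
  have hw := (HasPartials.const (x := x) 1).add ((HasPartials.const (sig * l2)).mul .p₂)
  have hD1 : HasPartials (D1' l1) x _ _ _ _ :=
    (HasPartials.p₁.mul .q₁).neg.add (.const (l1 ^ 2 / 2))
  have hM : HasPartials (M l1 l2) x _ _ _ _ := .const _
  have hH : HasPartials (H sig l2) x _ _ _ _ :=
    (HasPartials.p₂.sq.div (.const 2) two_ne_zero).add
      ((HasPartials.p₁.sq.div (.const 2) two_ne_zero).mul hw.sq)
  have hD : HasPartials (D sig l1 l2) x _ _ _ _ :=
    ((HasPartials.p₂.mul .q₂).neg.sub ((HasPartials.p₁.mul .q₁).div hw hx)).sub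
      ((HasPartials.const (l1 ^ 2 / 2)).mul (((HasPartials.const (sig * l2)).mul .p₂).div hw hx))
  have hC : HasPartials (C sig l1 l2) x _ _ _ _ :=
    (((HasPartials.q₂.sq.div (.const 2) two_ne_zero).add
      ((HasPartials.q₁.sq.div (.const 2) two_ne_zero).div hw.sq (pow_ne_zero 2 hx))).add
      (((HasPartials.const sig).mul hD1).mul (((HasPartials.const l2).mul .q₂).div hw hx))).add
      (((HasPartials.const (sig ^ 2 / 2)).mul hD1.sq).mul
        ((HasPartials.const (l2 ^ 2)).div hw.sq (pow_ne_zero 2 hx)))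
  have hP : HasPartials (P sig l1 l2) x _ _ _ _ :=
    ((HasPartials.const l2).mul .p₂).add (((HasPartials.const l1).mul .p₁).mul hw)
  have hK : HasPartials (K sig l1 l2) x _ _ _ _ :=
    (((HasPartials.const l2).mul .q₂).add (((HasPartials.const l1).mul .q₁).div hw hx)).add
      (((HasPartials.const sig).mul hD1).mul ((HasPartials.const (l2 ^ 2)).div hw hx))
  rw [hD.pb4_eq hP, hD.pb4_eq hK, hK.pb4_eq hP, hD.pb4_eq hH, hD.pb4_eq hC, hH.pb4_eq hC,
    hH.pb4_eq hP, hP.pb4_eq hC, hK.pb4_eq hH, hK.pb4_eq hC, hM.pb4_eq hD, hM.pb4_eq hH,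
    hM.pb4_eq hC, hM.pb4_eq hK, hM.pb4_eq hP]
  clear hw hD1 hM hH hD hC hP hK
  simp only [M, H, D, C, P, K, D1']
  obtain ⟨q₁, q₂, p₁, p₂⟩ := x
  dsimp only at hx ⊢
  generalize hw : 1 + sig * l2 * p₂ = w at hx ⊢
  refine ⟨?_, ?_, ?_, ?_, ?_, ?_, ?_, ?_, ?_, ?_, ?_, ?_, ?_, ?_, ?_⟩ <;>
    field_simp <;> subst hw <;> ring
end

section
/- Fix real constants σ, λ₁, λ₂. On the open set U = {(q₁,q₂,p₁,p₂) ∈ ℝ⁴ : 1 + σλ₂p₂ ≠ 0}, set D₁' = −p₁q₁ + λ₁²/2 and define 𝓗 = p₂²/2 + (p₁²/2)(1 + σλ₂p₂)²; 𝓓 = −p₂q₂ − p₁q₁/(1 + σλ₂p₂) − (λ₁²/2)·σλ₂p₂/(1 + σλ₂p₂); 𝓒 = q₂²/2 + (q₁²/2)/(1 + σλ₂p₂)² + σD₁'·λ₂q₂/(1 + σλ₂p₂) + (σ²/2)(D₁')²·λ₂²/(1 + σλ₂p₂)². Define the deformed oscillator Hamiltonian H_σ^(2) = 𝓗 + 𝓒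 and the function C_σ^(2) = (1/4)𝓓² − 𝓗𝓒. Then {H_σ^(2), C_σ^(2)} = 0 on U with respect to the canonical Poisson bracket on ℝ⁴, i.e. C_σ^(2) is an integral of motion for the σ-deformed two-dimensional isotropic oscillator. -/
namespace SchrodSigma

variable (sig l1 l2 : ℝ)

/-- The σ-deformed two-dimensional oscillator Hamiltonian `H_σ⁽²⁾ = 𝓗 + 𝓒`. -/
noncomputable def Ham : Phase4 → ℝ := fun x => H sig l2 x + C sig l1 l2 x

/-- The integral of motion `C_σ⁽²⁾ = (1/4)𝓓² − 𝓗𝓒`. -/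
noncomputable def Integral : Phase4 → ℝ := fun x =>
  (1 / 4) * (D sig l1 l2 x) ^ 2 - H sig l2 x * C sig l1 l2 x

end SchrodSigma

namespace SchrodSigma

/-- The Darboux coordinate `Q₁ = q₁ / (1 + σλ₂p₂)`. -/
noncomputable def Q1 (sig l2 : ℝ) : Phase4 → ℝ := fun x => x.1 * (1 + sig * l2 * x.2.2.2)⁻¹

/-- The Darboux coordinate `Q₂ = q₂ + σλ₂D₁' / (1 + σλ₂p₂)`. -/
noncomputable def Q2 (sig l1 l2 : ℝ) : Phase4 → ℝ := fun x =>
  x.2.1 + sig * l2 * (D1' l1 x * (1 + sig * l2 * x.2.2.2)⁻¹)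

/-- The Darboux coordinate `P₁ = p₁(1 + σλ₂p₂)`, conjugate to `Q₁`. -/
noncomputable def P1 (sig l2 : ℝ) : Phase4 → ℝ := fun x => x.2.2.1 * (1 + sig * l2 * x.2.2.2)

theorem Ham_eq (sig l1 l2 : ℝ) :
    Ham sig l1 l2 = fun x => (1 / 2 : ℝ) *
      (x.2.2.2 ^ 2 + P1 sig l2 x ^ 2 + (Q1 sig l2 x ^ 2 + Q2 sig l1 l2 x ^ 2)) := by
  funext x
  simp only [Ham, H, C, P1, Q1, Q2, div_eq_mul_inv, mul_pow, ← inv_pow]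
  ring

/-- Where the coordinates are defined, the integral is `-1/4` times the squared angular momentum. -/
theorem Integral_eq (sig l1 l2 : ℝ) {x : Phase4} (hx : 1 + sig * l2 * x.2.2.2 ≠ 0) :
    Integral sig l1 l2 x = (-1 / 4 : ℝ) *
      (P1 sig l2 x * Q2 sig l1 l2 x - x.2.2.2 * Q1 sig l2 x) ^ 2 := by
  simp only [Integral, D, H, C, D1', P1, Q1, Q2]
  generalize hu : 1 + sig * l2 * x.2.2.2 = u at hx ⊢
  field_simp
  subst hu
  ring

theorem Integral_eventuallyEq (sig l1 l2 : ℝ) {x : Phase4} (hx : 1 + sig * l2 * x.2.2.2 ≠ 0) :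
    Integral sig l1 l2 =ᶠ[nhds x] fun y => (-1 / 4 : ℝ) *
      (P1 sig l2 y * Q2 sig l1 l2 y - y.2.2.2 * Q1 sig l2 y) ^ 2 := by
  have hc : Continuous fun y : Phase4 => 1 + sig * l2 * y.2.2.2 := by fun_prop
  filter_upwards [hc.continuousAt.eventually_ne hx] with y hy
  exact Integral_eq sig l1 l2 hy

end SchrodSigma

open SchrodSigma in
/-- The function `C_σ⁽²⁾ = (1/4)𝓓² − 𝓗𝓒` Poisson-commutes with
the σ-deformed oscillator Hamiltonian `H_σ⁽²⁾ = 𝓗 + 𝓒` on `U = {1 + σλ₂p₂ ≠ 0}`. -/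
theorem sigma_oscillator_integral (sig l1 l2 : ℝ) :
    ∀ x : Phase4, 1 + sig * l2 * x.2.2.2 ≠ 0 →
      pb4 (Ham sig l1 l2) (Integral sig l1 l2) x = 0 := by
  intro x hx
  have hq1 : HasFDerivAt (fun y : Phase4 => y.1) (ContinuousLinearMap.fst ℝ ℝ (ℝ × ℝ × ℝ)) x :=
    hasFDerivAt_fst
  have ht : HasFDerivAt (fun y : Phase4 => y.2) (ContinuousLinearMap.snd ℝ ℝ (ℝ × ℝ × ℝ)) x :=
    hasFDerivAt_snd
  have hq2 : HasFDerivAt (fun y : Phase4 => y.2.1) _ x := ht.fst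
  have hp1 : HasFDerivAt (fun y : Phase4 => y.2.2.1) _ x := ht.snd.fst
  have hp2 : HasFDerivAt (fun y : Phase4 => y.2.2.2) _ x := ht.snd.snd
  have hu : HasFDerivAt (fun y : Phase4 => 1 + sig * l2 * y.2.2.2) _ x :=
    (hp2.const_mul (sig * l2)).const_add 1
  have hv : HasFDerivAt (fun y : Phase4 => (1 + sig * l2 * y.2.2.2)⁻¹) _ x :=
    (hasDerivAt_inv hx).comp_hasFDerivAt x hu
  have hQ1 : HasFDerivAt (Q1 sig l2) _ x := hq1.mul hv
  have hP1 : HasFDerivAt (P1 sig l2) _ x := hp1.mul hu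
  have hQ2 : HasFDerivAt (Q2 sig l1 l2) _ x :=
    hq2.add ((((hp1.mul hq1).neg.add_const (l1 ^ 2 / 2)).mul hv).const_mul (sig * l2))
  have hHam := (((hp2.pow 2).add (hP1.pow 2)).add
    ((hQ1.pow 2).add (hQ2.pow 2))).const_mul (1 / 2 : ℝ)
  have hInt := (((hP1.mul hQ2).sub (hp2.mul hQ1)).pow 2).const_mul (-1 / 4 : ℝ)
  have eHam : fderiv ℝ (Ham sig l1 l2) x = _ :=
    (congrArg (fderiv ℝ · x) (Ham_eq sig l1 l2)).trans hHam.fderiv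
  have eInt : fderiv ℝ (Integral sig l1 l2) x = _ :=
    (Integral_eventuallyEq sig l1 l2 hx).fderiv_eq.trans hInt.fderiv
  rw [pb4, eHam, eInt]
  simp [P1, Q1, Q2, D1']
  generalize hu : 1 + sig * l2 * x.2.2.2 = u at hx ⊢
  field_simp
  subst hu
  ring
end

section
/- Fix real constants τ, λ₁, λ₂. On the open set U = {(q₁,q₂,p₁,p₂) ∈ ℝ⁴ : 1 + τp₂²/2 > 0}, set D₁' = −p₁q₁ + λ₁²/2 and define: 𝓜 = λ₁² + λ₂²; 𝓗 = p₂²/2 + (p₁²/2)(1 + τp₂²/2); 𝓓 = −p₂q₂ − p₁q₁/(1 + τp₂²/2) − (λ₁²/2)·(τp₂²/2)/(1 + τp₂²/2); 𝓒 = q₂²/2 + (q₁²/2)/(1 + τp₂²/2) + (τ/2)D₁'·p₂q₂/(1 + τp₂²/2) + (τ²/4)(D₁')²·(p₂²/2)/(1 + τp₂²/2)²; 𝓟 = λ₂p₂ + λ₁p₁(1 + τp₂²/2)^{1/2}; 𝓚 = λ₂q₂ + λ₁q₁(1 + τp₂²/2)^{−1/2} + (τ/2)D₁'·λ₂p₂/(1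 + τp₂²/2). Then with respect to the canonical Poisson bracket on ℝ⁴ these six functions satisfy the Schrödinger Poisson algebra relations on U: {𝓓,𝓟} = −𝓟, {𝓓,𝓚} = 𝓚, {𝓚,𝓟} = 𝓜, {𝓓,𝓗} = −2𝓗, {𝓓,𝓒} = 2𝓒, {𝓗,𝓒} = 𝓓, {𝓗,𝓟} = 0, {𝓟,𝓒} = −𝓚, {𝓚,𝓗} = 𝓟, {𝓚,𝓒} = 0, and 𝓜 Poisson-commutes with all of them. -/
namespace SchrodTau

variable (tau l1 l2 : ℝ)

/-- `D₁' = −p₁q₁ + λ₁²/2`. -/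
noncomputable def D1' : Phase4 → ℝ := fun x => -(x.2.2.1 * x.1) + l1 ^ 2 / 2

noncomputable def M : Phase4 → ℝ := fun _ => l1 ^ 2 + l2 ^ 2
noncomputable def H : Phase4 → ℝ := fun x =>
  x.2.2.2 ^ 2 / 2 + (x.2.2.1 ^ 2 / 2) * (1 + tau * x.2.2.2 ^ 2 / 2)
noncomputable def D : Phase4 → ℝ := fun x =>
  -(x.2.2.2 * x.2.1) - x.2.2.1 * x.1 / (1 + tau * x.2.2.2 ^ 2 / 2) -
    (l1 ^ 2 / 2) * ((tau * x.2.2.2 ^ 2 / 2) / (1 + tau * x.2.2.2 ^ 2 / 2))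
noncomputable def C : Phase4 → ℝ := fun x =>
  x.2.1 ^ 2 / 2 + (x.1 ^ 2 / 2) / (1 + tau * x.2.2.2 ^ 2 / 2) +
    (tau / 2) * D1' l1 x * (x.2.2.2 * x.2.1 / (1 + tau * x.2.2.2 ^ 2 / 2)) +
    (tau ^ 2 / 4) * (D1' l1 x) ^ 2 *
      ((x.2.2.2 ^ 2 / 2) / (1 + tau * x.2.2.2 ^ 2 / 2) ^ 2)
noncomputable def P : Phase4 → ℝ := fun x =>
  l2 * x.2.2.2 + l1 * x.2.2.1 * Real.sqrt (1 + tau * x.2.2.2 ^ 2 / 2)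
noncomputable def K : Phase4 → ℝ := fun x =>
  l2 * x.2.1 + l1 * x.1 * (Real.sqrt (1 + tau * x.2.2.2 ^ 2 / 2))⁻¹ +
    (tau / 2) * D1' l1 x * (l2 * x.2.2.2 / (1 + tau * x.2.2.2 ^ 2 / 2))

end SchrodTau

/-- The canonical bracket of two covectors on `Phase4`. -/
noncomputable def covectorBracket (L N : Phase4 →L[ℝ] ℝ) : ℝ :=
  L (1, 0, 0, 0) * N (0, 0, 1, 0) - L (0, 0, 1, 0) * N (1, 0, 0, 0) +
  (L (0, 1, 0, 0) * N (0, 0, 0, 1) - L (0, 0, 0, 1) * N (0, 1, 0, 0))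

/-- Four covectors satisfying the canonical commutation relations. -/
structure IsDarbouxFrame (A₁ A₂ B₁ B₂ : Phase4 →L[ℝ] ℝ) : Prop where
  a₁b₁ : covectorBracket A₁ B₁ = 1
  a₂b₂ : covectorBracket A₂ B₂ = 1
  a₁a₂ : covectorBracket A₁ A₂ = 0
  b₁b₂ : covectorBracket B₁ B₂ = 0
  a₁b₂ : covectorBracket A₁ B₂ = 0
  a₂b₁ : covectorBracket A₂ B₁ = 0

/-- The Poisson bracket may be computed in any Darboux frame. -/
theorem IsDarbouxFrame.pb4_eq {A₁ A₂ B₁ B₂ : Phase4 →L[ℝ] ℝ}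
    (h : IsDarbouxFrame A₁ A₂ B₁ B₂) {f g : Phase4 → ℝ} {x : Phase4}
    {a₁ a₂ b₁ b₂ c₁ c₂ d₁ d₂ : ℝ}
    (hf : HasFDerivAt f (a₁ • A₁ + a₂ • A₂ + b₁ • B₁ + b₂ • B₂) x)
    (hg : HasFDerivAt g (c₁ • A₁ + c₂ • A₂ + d₁ • B₁ + d₂ • B₂) x) :
    pb4 f g x = a₁ * d₁ - b₁ * c₁ + (a₂ * d₂ - b₂ * c₂) := by
  obtain ⟨h₁, h₂, h₃, h₄, h₅, h₆⟩ := h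
  simp only [covectorBracket] at h₁ h₂ h₃ h₄ h₅ h₆
  simp only [pb4, hf.fderiv, hg.fderiv, add_apply, smul_apply, smul_eq_mul]
  linear_combination (a₁ * d₁ - b₁ * c₁) * h₁ + (a₂ * d₂ - b₂ * c₂) * h₂ +
    (a₁ * c₂ - a₂ * c₁) * h₃ + (b₁ * d₂ - b₂ * d₁) * h₄ +
    (a₁ * d₂ - b₂ * c₁) * h₅ + (a₂ * d₁ - b₁ * c₂) * h₆

theorem pb4_const_left (c : ℝ) (g : Phase4 → ℝ) (x : Phase4) : pb4 (fun _ => c) g x = 0 := by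
  simp [pb4]

namespace SchrodTau

variable (tau l1 : ℝ)

/-- The deformed first position `q₁ (1 + τp₂²/2)^{-1/2}`. -/
noncomputable def Q₁ : Phase4 → ℝ := fun x =>
  x.1 * (Real.sqrt (1 + tau * x.2.2.2 ^ 2 / 2))⁻¹

/-- The deformed second position `q₂ + (τ/2) D₁' p₂ / (1 + τp₂²/2)`. -/
noncomputable def Q₂ : Phase4 → ℝ := fun x =>
  x.2.1 + (tau / 2) * D1' l1 x * (x.2.2.2 / (1 + tau * x.2.2.2 ^ 2 / 2))

/-- The deformed first momentum `p₁ (1 + τp₂²/2)^{1/2}`. -/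
noncomputable def P₁ : Phase4 → ℝ := fun x =>
  x.2.2.1 * Real.sqrt (1 + tau * x.2.2.2 ^ 2 / 2)

/-- The second momentum `p₂`. -/
def P₂ : Phase4 → ℝ := fun x => x.2.2.2

variable {tau}

theorem exists_darbouxFrame {x : Phase4} (hx : 0 < 1 + tau * x.2.2.2 ^ 2 / 2) :
    ∃ A₁ A₂ B₁ B₂ : Phase4 →L[ℝ] ℝ, IsDarbouxFrame A₁ A₂ B₁ B₂ ∧
      HasFDerivAt (Q₁ tau) A₁ x ∧ HasFDerivAt (Q₂ tau l1) A₂ x ∧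
      HasFDerivAt (P₁ tau) B₁ x ∧ HasFDerivAt P₂ B₂ x := by
  have hq₁ : HasFDerivAt (fun y : Phase4 => y.1) (ContinuousLinearMap.fst ℝ ℝ (ℝ × ℝ × ℝ)) x :=
    hasFDerivAt_fst
  have h2 : HasFDerivAt (fun y : Phase4 => y.2) (ContinuousLinearMap.snd ℝ ℝ (ℝ × ℝ × ℝ)) x :=
    hasFDerivAt_snd
  have hq₂ := h2.fst
  have hp₁ := h2.snd.fst
  have hp₂ := h2.snd.snd
  have hu : HasFDerivAt (fun y : Phase4 => 1 + tau * y.2.2.2 ^ 2 / 2) _ x :=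
    (((hp₂.pow 2).const_mul tau).mul_const (2⁻¹ : ℝ)).const_add 1
  have hs := hu.sqrt hx.ne'
  have hsx := Real.sqrt_pos.2 hx
  have hsinv := (hasDerivAt_inv hsx.ne').comp_hasFDerivAt x hs
  have huinv := (hasDerivAt_inv hx.ne').comp_hasFDerivAt x hu
  have hQ₁ : HasFDerivAt (Q₁ tau) _ x := hq₁.mul hsinv
  have hP₁ : HasFDerivAt (P₁ tau) _ x := hp₁.mul hs
  have hD : HasFDerivAt (D1' l1) _ x := (hp₁.mul hq₁).neg.add_const (l1 ^ 2 / 2)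
  have hQ₂ : HasFDerivAt (Q₂ tau l1) _ x :=
    hq₂.add ((hD.const_mul (tau / 2)).mul (hp₂.mul huinv))
  refine ⟨_, _, _, _, ?_, hQ₁, hQ₂, hP₁, hp₂⟩
  have hsq := Real.sq_sqrt hx.le
  obtain ⟨q₁, q₂, p₁, p₂⟩ := x
  simp only at hsq hsx hx
  set s := Real.sqrt (1 + tau * p₂ ^ 2 / 2)
  constructor <;> simp [covectorBracket, ← hsq] <;> field_simp <;> ring

variable {l1}

theorem eventually_pos {x : Phase4} (hx : 0 < 1 + tau * x.2.2.2 ^ 2 / 2) :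
    ∀ᶠ y : Phase4 in nhds x, 0 < 1 + tau * y.2.2.2 ^ 2 / 2 :=
  (by fun_prop : Continuous fun y : Phase4 => 1 + tau * y.2.2.2 ^ 2 / 2).continuousAt.eventually
    (lt_mem_nhds hx)

theorem H_eq {y : Phase4} (hy : 0 < 1 + tau * y.2.2.2 ^ 2 / 2) :
    H tau y = (P₁ tau y ^ 2 + P₂ y ^ 2) / 2 := by
  simp only [H, P₁, P₂, mul_pow, Real.sq_sqrt hy.le]
  ring

theorem D_eq {y : Phase4} (hy : 0 < 1 + tau * y.2.2.2 ^ 2 / 2) :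
    D tau l1 y = -(P₁ tau y * Q₁ tau y + P₂ y * Q₂ tau l1 y) := by
  have hs := (Real.sqrt_pos.2 hy).ne'
  have h₁ : P₁ tau y * Q₁ tau y = y.2.2.1 * y.1 := by
    simp only [P₁, Q₁]
    generalize Real.sqrt (1 + tau * y.2.2.2 ^ 2 / 2) = s at *
    field_simp
  rw [h₁]
  simp only [D, P₂, Q₂, D1']
  have hy' := hy.ne'
  generalize hu : 1 + tau * y.2.2.2 ^ 2 / 2 = u at *
  field_simp
  subst hu
  ring

theorem C_eq {y : Phase4} (hy : 0 < 1 + tau * y.2.2.2 ^ 2 / 2) :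
    C tau l1 y = (Q₁ tau y ^ 2 + Q₂ tau l1 y ^ 2) / 2 := by
  simp only [C, Q₁, Q₂, mul_pow, inv_pow, Real.sq_sqrt hy.le]
  generalize 1 + tau * y.2.2.2 ^ 2 / 2 = u
  ring

theorem P_eq (l2 : ℝ) : P tau l1 l2 = fun y => l1 * P₁ tau y + l2 * P₂ y := by
  funext y
  simp only [P, P₁, P₂]
  ring

theorem K_eq (l2 : ℝ) : K tau l1 l2 = fun y => l1 * Q₁ tau y + l2 * Q₂ tau l1 y := by
  funext y
  simp only [K, Q₁, Q₂]
  ring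

end SchrodTau

open SchrodTau in
/-- The two-particle symplectic realization of the τ-deformed
('time-type') coproduct of the Schrödinger algebra satisfies the Schrödinger
Poisson algebra relations on `U = {1 + τp₂²/2 > 0}`. -/
theorem schrodinger_tau_comodule (tau l1 l2 : ℝ) :
    ∀ x : Phase4, 0 < 1 + tau * x.2.2.2 ^ 2 / 2 →
      pb4 (D tau l1) (P tau l1 l2) x = -P tau l1 l2 x ∧
      pb4 (D tau l1) (K tau l1 l2) x = K tau l1 l2 x ∧
      pb4 (K tau l1 l2) (P tau l1 l2) x = M l1 l2 x ∧
      pb4 (D tau l1) (H tau) x = -2 * H tau x ∧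
      pb4 (D tau l1) (C tau l1) x = 2 * C tau l1 x ∧
      pb4 (H tau) (C tau l1) x = D tau l1 x ∧
      pb4 (H tau) (P tau l1 l2) x = 0 ∧
      pb4 (P tau l1 l2) (C tau l1) x = -K tau l1 l2 x ∧
      pb4 (K tau l1 l2) (H tau) x = P tau l1 l2 x ∧
      pb4 (K tau l1 l2) (C tau l1) x = 0 ∧
      pb4 (M l1 l2) (D tau l1) x = 0 ∧
      pb4 (M l1 l2) (H tau) x = 0 ∧
      pb4 (M l1 l2) (C tau l1) x = 0 ∧
      pb4 (M l1 l2) (K tau l1 l2) x = 0 ∧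
      pb4 (M l1 l2) (P tau l1 l2) x = 0 := by
  intro x hx
  obtain ⟨A₁, A₂, B₁, B₂, hF, hQ₁, hQ₂, hP₁, hP₂⟩ := exists_darbouxFrame l1 hx
  have hU := eventually_pos hx
  have hH : HasFDerivAt (H tau)
      ((0 : ℝ) • A₁ + (0 : ℝ) • A₂ + P₁ tau x • B₁ + P₂ x • B₂) x := by
    refine HasFDerivAt.congr_of_eventuallyEq ?_ (hU.mono fun y hy => H_eq hy)
    refine (((hP₁.pow 2).add (hP₂.pow 2)).mul_const (2⁻¹ : ℝ)).congr_fderiv ?_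
    exact ContinuousLinearMap.ext fun v => by simp; ring
  have hD : HasFDerivAt (D tau l1)
      ((-P₁ tau x) • A₁ + (-P₂ x) • A₂ + (-Q₁ tau x) • B₁ + (-Q₂ tau l1 x) • B₂) x := by
    refine HasFDerivAt.congr_of_eventuallyEq ?_ (hU.mono fun y hy => D_eq hy)
    refine ((hP₁.mul hQ₁).add (hP₂.mul hQ₂)).neg.congr_fderiv ?_
    exact ContinuousLinearMap.ext fun v => by simp; ring
  have hC : HasFDerivAt (C tau l1)
      (Q₁ tau x • A₁ + Q₂ tau l1 x • A₂ + (0 : ℝ) • B₁ + (0 : ℝ) • B₂) x := by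
    refine HasFDerivAt.congr_of_eventuallyEq ?_ (hU.mono fun y hy => C_eq hy)
    refine (((hQ₁.pow 2).add (hQ₂.pow 2)).mul_const (2⁻¹ : ℝ)).congr_fderiv ?_
    exact ContinuousLinearMap.ext fun v => by simp; ring
  have hP : HasFDerivAt (P tau l1 l2)
      ((0 : ℝ) • A₁ + (0 : ℝ) • A₂ + l1 • B₁ + l2 • B₂) x := by
    rw [P_eq]
    exact ((hP₁.const_mul l1).add (hP₂.const_mul l2)).congr_fderiv (by simp)
  have hK : HasFDerivAt (K tau l1 l2)
      (l1 • A₁ + l2 • A₂ + (0 : ℝ) • B₁ + (0 : ℝ) • B₂) x := by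
    rw [K_eq]
    exact ((hQ₁.const_mul l1).add (hQ₂.const_mul l2)).congr_fderiv (by simp)
  rw [hF.pb4_eq hD hP, hF.pb4_eq hD hK, hF.pb4_eq hK hP, hF.pb4_eq hD hH, hF.pb4_eq hD hC,
    hF.pb4_eq hH hC, hF.pb4_eq hH hP, hF.pb4_eq hP hC, hF.pb4_eq hK hH, hF.pb4_eq hK hC,
    H_eq hx, D_eq hx, C_eq hx, P_eq, K_eq,
    show M l1 l2 x = l1 ^ 2 + l2 ^ 2 from rfl]
  refine ⟨?_, ?_, ?_, ?_, ?_, ?_, ?_, ?_, ?_, ?_, pb4_const_left _ _ x, pb4_const_left _ _ x,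
    pb4_const_left _ _ x, pb4_const_left _ _ x, pb4_const_left _ _ x⟩ <;>
  ring
end

section
/- Fix real constants τ, λ₁, λ₂. On the open set U = {(q₁,q₂,p₁,p₂) ∈ ℝ⁴ : 1 + τp₂²/2 > 0}, set D₁' = −p₁q₁ + λ₁²/2 and define 𝓗 = p₂²/2 + (p₁²/2)(1 + τp₂²/2); 𝓓 = −p₂q₂ − p₁q₁/(1 + τp₂²/2) − (λ₁²/2)·(τp₂²/2)/(1 + τp₂²/2); 𝓒 = q₂²/2 + (q₁²/2)/(1 + τp₂²/2) + (τ/2)D₁'·p₂q₂/(1 + τp₂²/2) + (τ²/4)(D₁')²·(p₂²/2)/(1 + τp₂²/2)². Define H_τ^(2) = 𝓗 + 𝓒 and C_τ^(2) = (1/4)𝓓² − 𝓗𝓒. Then {H_τ^(2), C_τ^(2)} = 0 on U with respect to the canonical Poisson bracket on ℝ⁴, i.e. C_τ^(2) is an integral of motion for the τ-deformed two-dimensional isotropic oscillator. -/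
namespace SchrodTau

variable (tau l1 : ℝ)

/-- The τ-deformed two-dimensional oscillator Hamiltonian `H_τ⁽²⁾ = 𝓗 + 𝓒`. -/
noncomputable def Ham : Phase4 → ℝ := fun x => H tau x + C tau l1 x

/-- The integral of motion `C_τ⁽²⁾ = (1/4)𝓓² − 𝓗𝓒`. -/
noncomputable def Integral : Phase4 → ℝ := fun x =>
  (1 / 4) * (D tau l1 x) ^ 2 - H tau x * C tau l1 x

end SchrodTau

/-- The covector `a dq₁ + b dq₂ + c dp₁ + d dp₂` on `ℝ⁴`. -/
noncomputable def covector4 (a b c d : ℝ) : Phase4 →L[ℝ] ℝ :=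
  a • ContinuousLinearMap.fst ℝ ℝ (ℝ × ℝ × ℝ) +
  (b • ContinuousLinearMap.fst ℝ ℝ (ℝ × ℝ) +
    (c • ContinuousLinearMap.fst ℝ ℝ ℝ + d • ContinuousLinearMap.snd ℝ ℝ ℝ).comp
      (ContinuousLinearMap.snd ℝ ℝ (ℝ × ℝ))).comp (ContinuousLinearMap.snd ℝ ℝ (ℝ × ℝ × ℝ))

theorem covector4_apply (a b c d : ℝ) (v : Phase4) :
    covector4 a b c d v = a * v.1 + b * v.2.1 + c * v.2.2.1 + d * v.2.2.2 := by
  simp [covector4]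
  ring

section Derivatives

variable {f g : Phase4 → ℝ} {x : Phase4} {a b c d a' b' c' d' : ℝ}

theorem HasFDerivAt.covector4_add (hf : HasFDerivAt f (covector4 a b c d) x)
    (hg : HasFDerivAt g (covector4 a' b' c' d') x) :
    HasFDerivAt (fun y => f y + g y) (covector4 (a + a') (b + b') (c + c') (d + d')) x := by
  refine (hf.add hg).congr_fderiv (ContinuousLinearMap.ext fun v => ?_)
  simp only [add_apply, covector4_apply]
  ring

theorem HasFDerivAt.covector4_mul (hf : HasFDerivAt f (covector4 a b c d) x)
    (hg : HasFDerivAt g (covector4 a' b' c' d') x) :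
    HasFDerivAt (fun y => f y * g y) (covector4 (f x * a' + g x * a) (f x * b' + g x * b)
      (f x * c' + g x * c) (f x * d' + g x * d)) x := by
  refine (hf.mul hg).congr_fderiv (ContinuousLinearMap.ext fun v => ?_)
  simp only [add_apply, smul_apply, smul_eq_mul,
    covector4_apply]
  ring

theorem HasFDerivAt.covector4_inv (hf : HasFDerivAt f (covector4 a b c d) x) (h : f x ≠ 0) :
    HasFDerivAt (fun y => (f y)⁻¹) (covector4 (-(f x ^ 2)⁻¹ * a) (-(f x ^ 2)⁻¹ * b)
      (-(f x ^ 2)⁻¹ * c) (-(f x ^ 2)⁻¹ * d)) x := by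
  refine ((hasDerivAt_inv h).comp_hasFDerivAt x hf).congr_fderiv
    (ContinuousLinearMap.ext fun v => ?_)
  simp only [smul_apply, smul_eq_mul, covector4_apply]
  ring

theorem hasFDerivAt_const_covector4 (k : ℝ) (x : Phase4) :
    HasFDerivAt (fun _ => k) (covector4 0 0 0 0) x :=
  (hasFDerivAt_const k x).congr_fderiv (ContinuousLinearMap.ext fun v => by
    simp [covector4_apply])

theorem hasFDerivAt_q₁ (x : Phase4) : HasFDerivAt (fun y : Phase4 => y.1) (covector4 1 0 0 0) x :=
  hasFDerivAt_fst.congr_fderiv (ContinuousLinearMap.ext fun v => by simp [covector4_apply])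

theorem hasFDerivAt_q₂ (x : Phase4) :
    HasFDerivAt (fun y : Phase4 => y.2.1) (covector4 0 1 0 0) x :=
  hasFDerivAt_snd.fst.congr_fderiv (ContinuousLinearMap.ext fun v => by simp [covector4_apply])

theorem hasFDerivAt_p₁ (x : Phase4) :
    HasFDerivAt (fun y : Phase4 => y.2.2.1) (covector4 0 0 1 0) x :=
  hasFDerivAt_snd.snd.fst.congr_fderiv
    (ContinuousLinearMap.ext fun v => by simp [covector4_apply])

theorem hasFDerivAt_p₂ (x : Phase4) :
    HasFDerivAt (fun y : Phase4 => y.2.2.2) (covector4 0 0 0 1) x :=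
  hasFDerivAt_snd.snd.snd.congr_fderiv
    (ContinuousLinearMap.ext fun v => by simp [covector4_apply])

theorem pb4_eq_of_hasFDerivAt (hf : HasFDerivAt f (covector4 a b c d) x)
    (hg : HasFDerivAt g (covector4 a' b' c' d') x) :
    pb4 f g x = a * c' - c * a' + (b * d' - d * b') := by
  simp [pb4, hf.fderiv, hg.fderiv, covector4_apply]

end Derivatives

namespace SchrodTau

variable (tau l1 : ℝ) {x : Phase4}

theorem two_add_ne_zero (hx : 1 + tau * x.2.2.2 ^ 2 / 2 ≠ 0) : 2 + tau * x.2.2.2 ^ 2 ≠ 0 :=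
  fun h => hx (by linear_combination h / 2)

theorem hasFDerivAt_deformation (x : Phase4) :
    HasFDerivAt (fun y : Phase4 => 1 + tau * y.2.2.2 ^ 2 / 2)
      (covector4 0 0 0 (tau * x.2.2.2)) x := by
  have h := (hasFDerivAt_const_covector4 1 x).covector4_add
    ((hasFDerivAt_const_covector4 (tau / 2) x).covector4_mul
      ((hasFDerivAt_p₂ x).covector4_mul (hasFDerivAt_p₂ x)))
  convert h using 1
  · funext y; ring
  · congr 1 <;> ring

theorem hasFDerivAt_D1' (x : Phase4) :
    HasFDerivAt (D1' l1) (covector4 (-x.2.2.1) 0 (-x.1) 0) x := by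
  have h := ((hasFDerivAt_const_covector4 (-1) x).covector4_mul
    ((hasFDerivAt_p₁ x).covector4_mul (hasFDerivAt_q₁ x))).covector4_add
      (hasFDerivAt_const_covector4 (l1 ^ 2 / 2) x)
  convert h using 1
  · funext y; simp only [D1']; ring
  · congr 1 <;> ring

theorem hasFDerivAt_H (x : Phase4) :
    HasFDerivAt (H tau) (covector4 0 0 (x.2.2.1 * (1 + tau * x.2.2.2 ^ 2 / 2))
      (x.2.2.2 + x.2.2.1 ^ 2 / 2 * (tau * x.2.2.2))) x := by
  have h := ((hasFDerivAt_const_covector4 (1 / 2) x).covector4_mul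
    ((hasFDerivAt_p₂ x).covector4_mul (hasFDerivAt_p₂ x))).covector4_add
      (((hasFDerivAt_const_covector4 (1 / 2) x).covector4_mul
        ((hasFDerivAt_p₁ x).covector4_mul (hasFDerivAt_p₁ x))).covector4_mul
          (hasFDerivAt_deformation tau x))
  convert h using 1
  · funext y; simp only [H]; ring
  · congr 1 <;> ring

theorem hasFDerivAt_D (hx : 1 + tau * x.2.2.2 ^ 2 / 2 ≠ 0) :
    HasFDerivAt (D tau l1) (covector4
      (-x.2.2.1 / (1 + tau * x.2.2.2 ^ 2 / 2)) (-x.2.2.2)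
      (-x.1 / (1 + tau * x.2.2.2 ^ 2 / 2))
      (-x.2.1 + (x.2.2.1 * x.1 - l1 ^ 2 / 2) * (tau * x.2.2.2) /
        (1 + tau * x.2.2.2 ^ 2 / 2) ^ 2)) x := by
  have hx' := two_add_ne_zero tau hx
  have hm := hasFDerivAt_const_covector4 (-1) x
  have hw := (hasFDerivAt_deformation tau x).covector4_inv hx
  have h := (hm.covector4_mul ((hasFDerivAt_p₂ x).covector4_mul (hasFDerivAt_q₂ x))).covector4_add
    ((hm.covector4_mul (((hasFDerivAt_p₁ x).covector4_mul (hasFDerivAt_q₁ x)).covector4_mul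
      hw)).covector4_add ((hasFDerivAt_const_covector4 (-(l1 ^ 2 * tau / 4)) x).covector4_mul
        (((hasFDerivAt_p₂ x).covector4_mul (hasFDerivAt_p₂ x)).covector4_mul hw)))
  convert h using 1
  · funext y; simp only [D]; generalize 1 + tau * y.2.2.2 ^ 2 / 2 = u; ring
  · congr 1 <;> field_simp <;> ring

theorem hasFDerivAt_C (hx : 1 + tau * x.2.2.2 ^ 2 / 2 ≠ 0) :
    HasFDerivAt (C tau l1) (covector4
      (x.1 / (1 + tau * x.2.2.2 ^ 2 / 2) -
        tau / 2 * x.2.2.1 * x.2.2.2 * x.2.1 / (1 + tau * x.2.2.2 ^ 2 / 2) -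
        tau ^ 2 / 4 * D1' l1 x * x.2.2.1 * x.2.2.2 ^ 2 / (1 + tau * x.2.2.2 ^ 2 / 2) ^ 2)
      (x.2.1 + tau / 2 * D1' l1 x * x.2.2.2 / (1 + tau * x.2.2.2 ^ 2 / 2))
      (-(tau / 2 * x.1 * x.2.2.2 * x.2.1 / (1 + tau * x.2.2.2 ^ 2 / 2)) -
        tau ^ 2 / 4 * D1' l1 x * x.1 * x.2.2.2 ^ 2 / (1 + tau * x.2.2.2 ^ 2 / 2) ^ 2)
      (-(x.1 ^ 2 / 2 * (tau * x.2.2.2) / (1 + tau * x.2.2.2 ^ 2 / 2) ^ 2) +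
        tau / 2 * D1' l1 x * x.2.1 * (1 - tau * x.2.2.2 ^ 2 / 2) /
          (1 + tau * x.2.2.2 ^ 2 / 2) ^ 2 +
        tau ^ 2 / 4 * D1' l1 x ^ 2 * x.2.2.2 * (1 - tau * x.2.2.2 ^ 2 / 2) /
          (1 + tau * x.2.2.2 ^ 2 / 2) ^ 3)) x := by
  have hx' := two_add_ne_zero tau hx
  have hw := (hasFDerivAt_deformation tau x).covector4_inv hx
  have hs := (((hasFDerivAt_const_covector4 (tau / 2) x).covector4_mul
    (hasFDerivAt_D1' l1 x)).covector4_mul ((hasFDerivAt_p₂ x).covector4_mul hw))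
  have hc := hasFDerivAt_const_covector4 (1 / 2) x
  have h := (hc.covector4_mul ((hasFDerivAt_q₂ x).covector4_mul (hasFDerivAt_q₂ x))).covector4_add
    ((hc.covector4_mul (((hasFDerivAt_q₁ x).covector4_mul (hasFDerivAt_q₁ x)).covector4_mul
      hw)).covector4_add ((hs.covector4_mul (hasFDerivAt_q₂ x)).covector4_add
        (hc.covector4_mul (hs.covector4_mul hs))))
  convert h using 1
  · funext y; simp only [C]; generalize 1 + tau * y.2.2.2 ^ 2 / 2 = u; ring
  · congr 1 <;> field_simp <;> ring

theorem pb4_D_H (hx : 1 + tau * x.2.2.2 ^ 2 / 2 ≠ 0) :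
    pb4 (D tau l1) (H tau) x = -2 * H tau x := by
  have hx' := two_add_ne_zero tau hx
  rw [pb4_eq_of_hasFDerivAt (hasFDerivAt_D tau l1 hx) (hasFDerivAt_H tau x), H]
  field_simp
  ring

theorem pb4_D_C (hx : 1 + tau * x.2.2.2 ^ 2 / 2 ≠ 0) :
    pb4 (D tau l1) (C tau l1) x = 2 * C tau l1 x := by
  have hx' := two_add_ne_zero tau hx
  rw [pb4_eq_of_hasFDerivAt (hasFDerivAt_D tau l1 hx) (hasFDerivAt_C tau l1 hx), C, D1']
  field_simp
  ring

theorem pb4_C_H (hx : 1 + tau * x.2.2.2 ^ 2 / 2 ≠ 0) :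
    pb4 (C tau l1) (H tau) x = -D tau l1 x := by
  have hx' := two_add_ne_zero tau hx
  rw [pb4_eq_of_hasFDerivAt (hasFDerivAt_C tau l1 hx) (hasFDerivAt_H tau x), D, D1']
  field_simp
  ring

end SchrodTau

open SchrodTau in
/-- The function `C_τ⁽²⁾ = (1/4)𝓓² − 𝓗𝓒` Poisson-commutes with
the τ-deformed oscillator Hamiltonian `H_τ⁽²⁾ = 𝓗 + 𝓒` on `U = {1 + τp₂²/2 > 0}`. -/
theorem tau_oscillator_integral (tau l1 l2 : ℝ) :
    ∀ x : Phase4, 0 < 1 + tau * x.2.2.2 ^ 2 / 2 →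
      pb4 (Ham tau l1) (Integral tau l1) x = 0 := by
  intro x hx
  have hH := hasFDerivAt_H tau x
  have hD := hasFDerivAt_D tau l1 hx.ne'
  have hC := hasFDerivAt_C tau l1 hx.ne'
  have hDH := pb4_D_H tau l1 hx.ne'
  have hDC := pb4_D_C tau l1 hx.ne'
  have hCH := pb4_C_H tau l1 hx.ne'
  have hHam : HasFDerivAt (Ham tau l1) _ x := hH.add hC
  have hInt : HasFDerivAt (Integral tau l1) _ x :=
    ((hD.pow 2).const_mul (1 / 4)).sub (hH.mul hC)
  simp only [pb4, hH.fderiv, hD.fderiv, hC.fderiv] at hDH hDC hCH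
  simp only [pb4, hHam.fderiv, hInt.fderiv, add_apply,
    sub_apply, smul_apply, smul_eq_mul, nsmul_eq_mul]
  push_cast
  linear_combination (-(1 / 2) * D tau l1 x) * (hDH + hDC) + (H tau x - C tau l1 x) * hCH
end
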